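/- arXiv:1408.1815 — 3 statements merged into one kernel-verified Lean document; each statement's English description precedes it below -/
import Mathlib

section
/- Let d ≥ 1, let T be a measure preserving ℤ^d-action on a σ-finite standard measure space (X, μ), and suppose T is recurrent along a line θ ∈ P(ℝ^d). Then for every ε > 0, every compact K ⊂ ℝ^d, and every measurable A ⊆ X with 0 < μ(A) < ∞, there exist countably many pairwise disjoint measurable subsets A_1, A_2, … of A and elements γ_1, γ_2, … of ℤ^d \ K such that dist(γ_i, θ) < ε for every i, the images T_{γ_1} A_1, T_{γ_2} A_2, … are pairwise disjoint subsets of A, and μ(⋃_i A_i) ≥ μ(A)/2. -/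
open MeasureTheory Filter Set Topology

noncomputable section

instance {d : ℕ} : TopologicalSpace (Projectivization ℝ (Fin d → ℝ)) :=
  inferInstanceAs (TopologicalSpace (Quotient _))

/-- The coordinatewise cast of an integer vector to a real vector. -/
def zcast {d : ℕ} (γ : Fin d → ℤ) : Fin d → ℝ := fun i => (γ i : ℝ)

/-- `T` is a measure preserving `ℤ^d`-action on `(X, μ)`. -/
def IsMPAction {d : ℕ} {X : Type*} [MeasurableSpace X] (μ : Measure X)
    (T : (Fin d → ℤ) → X ≃ᵐ X) : Prop :=
  (∀ γ γ' : Fin d → ℤ, ∀ x : X, T (γ + γ') x = T γ (T γ' x)) ∧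
    ∀ γ : Fin d → ℤ, MeasurePreserving (T γ) μ μ

/-- The action `T` is free. -/
def IsFreeAction {d : ℕ} {X : Type*} [MeasurableSpace X] (μ : Measure X)
    (T : (Fin d → ℤ) → X ≃ᵐ X) : Prop :=
  ∀ γ : Fin d → ℤ, γ ≠ 0 → ∀ᵐ x ∂μ, T γ x ≠ x

/-- `T` is recurrent along the line `θ ∈ P(ℝ^d)`. -/
def RecurrentAlong {d : ℕ} {X : Type*} [MeasurableSpace X] (μ : Measure X)
    (T : (Fin d → ℤ) → X ≃ᵐ X) (θ : Projectivization ℝ (Fin d → ℝ)) : Prop :=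
  ∀ ε : ℝ, 0 < ε → ∀ A : Set X, MeasurableSet A → 0 < μ A →
    ∃ γ : Fin d → ℤ, γ ≠ 0 ∧ ∃ v ∈ θ.submodule, ‖zcast γ - v‖ < ε ∧ 0 < μ (A ∩ T γ '' A)

/-- The set of recurrent directions `𝓡(T)`. -/
def recSet {d : ℕ} {X : Type*} [MeasurableSpace X] (μ : Measure X)
    (T : (Fin d → ℤ) → X ≃ᵐ X) : Set (Projectivization ℝ (Fin d → ℝ)) :=
  {θ | RecurrentAlong μ T θ}

/-- `T` is rigid along the line `θ ∈ P(ℝ^d)`. -/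
def RigidAlong {d : ℕ} {X : Type*} [MeasurableSpace X] (μ : Measure X)
    (T : (Fin d → ℤ) → X ≃ᵐ X) (θ : Projectivization ℝ (Fin d → ℝ)) : Prop :=
  ∃ γ : ℕ → Fin d → ℤ,
    Tendsto (fun n => ‖zcast (γ n)‖) atTop atTop ∧
    Tendsto (fun n => Metric.infDist (zcast (γ n)) ((θ.submodule : Set (Fin d → ℝ)))) atTop (𝓝 0) ∧
    ∀ A : Set X, MeasurableSet A → μ A < ⊤ →
      Tendsto (fun n => μ (A ∩ T (γ n) '' A)) atTop (𝓝 (μ A))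

/-- The set of rigid directions `𝓡i(T)`. -/
def rigSet {d : ℕ} {X : Type*} [MeasurableSpace X] (μ : Measure X)
    (T : (Fin d → ℤ) → X ≃ᵐ X) : Set (Projectivization ℝ (Fin d → ℝ)) :=
  {θ | RigidAlong μ T θ}

/-- The measure `Leb × μ` on `[0,1)^d × X`. -/
def indMeasure {d : ℕ} {X : Type*} [MeasurableSpace X] (μ : Measure X) :
    Measure ((Fin d → ℝ) × X) :=
  (Measure.pi fun _ : Fin d => (volume : Measure ℝ).restrict (Set.Ico 0 1)).prod μ

/-- The induced `ℝ^d`-action `T̃_t(y, x) = ({t+y}, T_{[t+y]} x)`. -/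
def indMap {d : ℕ} {X : Type*} [MeasurableSpace X] (T : (Fin d → ℤ) → X ≃ᵐ X)
    (t : Fin d → ℝ) : (Fin d → ℝ) × X → (Fin d → ℝ) × X :=
  fun p => (fun i => Int.fract (t i + p.1 i), T (fun i => ⌊t i + p.1 i⌋) p.2)

/-- A one-parameter flow `F` on `(Y, ν)` is conservative. -/
def FlowConservative {Y : Type*} [MeasurableSpace Y] (ν : Measure Y) (F : ℝ → Y → Y) : Prop :=
  ∀ B : Set Y, MeasurableSet B → 0 < ν B → ∀ K : Set ℝ, IsCompact K →
    ∃ s : ℝ, s ∉ K ∧ 0 < ν (B ∩ F s '' B)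

/-- A one-parameter flow `F` on `(Y, ν)` is rigid. -/
def FlowRigid {Y : Type*} [MeasurableSpace Y] (ν : Measure Y) (F : ℝ → Y → Y) : Prop :=
  ∃ s : ℕ → ℝ, Tendsto s atTop atTop ∧
    ∀ B : Set Y, MeasurableSet B → ν B < ⊤ →
      Tendsto (fun n => ν (B ∩ F (s n) '' B)) atTop (𝓝 (ν B))

/-- An `ℝ^d`-action `R` on `(Y, ν)` is recurrent along the line `θ`: the flow along some
(equivalently, every) nonzero vector of `θ` is conservative. -/
def ActionRecurrentAlong {d : ℕ} {Y : Type*} [MeasurableSpace Y] (ν : Measure Y)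
    (R : (Fin d → ℝ) → Y → Y) (θ : Projectivization ℝ (Fin d → ℝ)) : Prop :=
  ∃ v ∈ θ.submodule, v ≠ (0 : Fin d → ℝ) ∧ FlowConservative ν (fun s => R (s • v))

/-- An `ℝ^d`-action `R` on `(Y, ν)` is rigid along the line `θ`. -/
def ActionRigidAlong {d : ℕ} {Y : Type*} [MeasurableSpace Y] (ν : Measure Y)
    (R : (Fin d → ℝ) → Y → Y) (θ : Projectivization ℝ (Fin d → ℝ)) : Prop :=
  ∃ v ∈ θ.submodule, v ≠ (0 : Fin d → ℝ) ∧ FlowRigid ν (fun s => R (s • v))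

theorem zcast_add {d : ℕ} (γ γ' : Fin d → ℤ) : zcast (γ + γ') = zcast γ + zcast γ' := by
  ext i
  simp [zcast]

theorem zcast_neg {d : ℕ} (γ : Fin d → ℤ) : zcast (-γ) = -zcast γ := by
  ext i
  simp [zcast]

theorem norm_zcast_lt_one_iff {d : ℕ} {γ : Fin d → ℤ} : ‖zcast γ‖ < 1 ↔ γ = 0 := by
  refine ⟨fun h => ?_, fun h => ?_⟩
  · ext i
    have hi : |(γ i : ℝ)| < 1 := (norm_le_pi_norm (zcast γ) i).trans_lt h
    exact Int.abs_lt_one_iff.mp (by exact_mod_cast hi)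
  · have h0 : zcast γ = 0 := by
      ext i
      simp [zcast, h]
    simp [h0]

/-- On a line, the sup norm is computed by a single coordinate. -/
theorem exists_coord_norm_le {d : ℕ} (θ : Projectivization ℝ (Fin d → ℝ)) :
    ∃ i : Fin d, ∀ w ∈ θ.submodule, ‖w‖ ≤ |w i| := by
  have hne : Nonempty (Fin d) := by
    by_contra h
    rw [not_nonempty_iff] at h
    exact θ.rep_nonzero (Subsingleton.elim _ _)
  obtain ⟨i, hi⟩ := Finite.exists_max fun i => |θ.rep i|
  refine ⟨i, fun w hw => ?_⟩
  rw [Projectivization.submodule_eq, Submodule.mem_span_singleton] at hw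
  obtain ⟨a, rfl⟩ := hw
  refine (pi_norm_le_iff_of_nonneg (abs_nonneg _)).mpr fun j => ?_
  simp only [Pi.smul_apply, smul_eq_mul, norm_mul, Real.norm_eq_abs, abs_mul]
  exact mul_le_mul_of_nonneg_left (hi j) (abs_nonneg a)

section Action

variable {d : ℕ} {X : Type*} [MeasurableSpace X] {μ : Measure X} {T : (Fin d → ℤ) → X ≃ᵐ X}

theorem IsMPAction.zero_apply (hT : IsMPAction μ T) (x : X) : T 0 x = x :=
  (T 0).injective (by rw [← hT.1, add_zero])

theorem IsMPAction.neg_apply_apply (hT : IsMPAction μ T) (γ : Fin d → ℤ) (x : X) :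
    T (-γ) (T γ x) = x := by
  rw [← hT.1, neg_add_cancel, hT.zero_apply]

theorem IsMPAction.measure_image (hT : IsMPAction μ T) (γ : Fin d → ℤ) (s : Set X) :
    μ (T γ '' s) = μ s := by
  rw [← (hT.2 γ).measure_preimage_equiv, preimage_image_eq _ (T γ).injective]

theorem IsMPAction.measure_inter_image_neg (hT : IsMPAction μ T) (γ : Fin d → ℤ) (s : Set X) :
    μ (s ∩ T (-γ) '' s) = μ (s ∩ T γ '' s) := by
  have h : s ∩ T (-γ) '' s = T (-γ) '' (s ∩ T γ '' s) := by
    rw [image_inter (T (-γ)).injective, image_image]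
    simp only [hT.neg_apply_apply, image_id']
    exact inter_comm _ _
  rw [h, hT.measure_image]

variable {θ : Projectivization ℝ (Fin d → ℝ)}

/-- Return times close to `θ` can be taken with a positive leading coordinate. -/
theorem RecurrentAlong.exists_one_le_coord (hT : IsMPAction μ T) (hrec : RecurrentAlong μ T θ)
    {i : Fin d} (hi : ∀ w ∈ θ.submodule, ‖w‖ ≤ |w i|) {ε : ℝ} (hε : 0 < ε)
    {B : Set X} (hB : MeasurableSet B) (hpos : 0 < μ B) :
    ∃ γ : Fin d → ℤ, 1 ≤ γ i ∧ ∃ v ∈ θ.submodule, ‖zcast γ - v‖ < ε ∧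
      0 < μ (B ∩ T γ '' B) := by
  obtain ⟨γ, hγ, v, hv, hdist, hμ⟩ := hrec (min ε (1 / 2)) (by positivity) B hB hpos
  obtain ⟨hdist, hhalf⟩ := lt_min_iff.mp hdist
  have hγi : γ i ≠ 0 := by
    intro h0
    have hvi : |v i| < 1 / 2 := by
      have := (norm_le_pi_norm (zcast γ - v) i).trans_lt hhalf
      simpa [zcast, h0] using this
    refine hγ (norm_zcast_lt_one_iff.mp ?_)
    have := norm_add_le (zcast γ - v) v
    rw [sub_add_cancel] at this
    linarith [hi v hv]
  rcases lt_or_gt_of_ne hγi with h | h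
  · refine ⟨-γ, by simp only [Pi.neg_apply]; lia, -v, neg_mem hv, ?_, ?_⟩
    · rwa [zcast_neg, ← neg_sub', norm_neg]
    · rwa [hT.measure_inter_image_neg]
  · exact ⟨γ, h, v, hv, hdist, hμ⟩

/-- Adding up return times makes the leading coordinate arbitrarily large. -/
theorem RecurrentAlong.exists_le_coord (hT : IsMPAction μ T) (hrec : RecurrentAlong μ T θ)
    {i : Fin d} (hi : ∀ w ∈ θ.submodule, ‖w‖ ≤ |w i|) (n : ℕ) :
    ∀ ε : ℝ, 0 < ε → ∀ B : Set X, MeasurableSet B → 0 < μ B →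
    ∃ γ : Fin d → ℤ, (n : ℤ) ≤ γ i ∧ ∃ v ∈ θ.submodule, ‖zcast γ - v‖ < ε ∧
      0 < μ (B ∩ T γ '' B) := by
  induction n with
  | zero =>
    intro ε hε B _ hpos
    have h0 : zcast (0 : Fin d → ℤ) = 0 := by ext; simp [zcast]
    exact ⟨0, by simp, 0, zero_mem _, by simpa [h0] using hε, by simpa [hT.zero_apply] using hpos⟩
  | succ n ih =>
    intro ε hε B hB hpos
    obtain ⟨γ, hγ, v, hv, hdist, hμ⟩ := hrec.exists_one_le_coord hT hi (half_pos hε) hB hpos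
    obtain ⟨γ', hγ', v', hv', hdist', hμ'⟩ := ih (ε / 2) (half_pos hε) (B ∩ T γ '' B)
      (hB.inter ((T γ).measurableSet_image.mpr hB)) hμ
    refine ⟨γ' + γ, by push_cast; simp only [Pi.add_apply]; lia, v' + v, add_mem hv' hv, ?_, ?_⟩
    · rw [zcast_add, add_sub_add_comm]
      exact (norm_add_le _ _).trans_lt (by linarith)
    · refine hμ'.trans_le (measure_mono ?_)
      rintro x ⟨⟨hx, -⟩, y, ⟨-, z, hz, rfl⟩, rfl⟩
      exact ⟨hx, z, hz, hT.1 _ _ _⟩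

/-- Recurrence along a line is witnessed by return times outside any compact set. -/
theorem RecurrentAlong.exists_notMem_isCompact (hT : IsMPAction μ T)
    (hrec : RecurrentAlong μ T θ) {ε : ℝ} (hε : 0 < ε) {K : Set (Fin d → ℝ)} (hK : IsCompact K)
    {B : Set X} (hB : MeasurableSet B) (hpos : 0 < μ B) :
    ∃ γ : Fin d → ℤ, zcast γ ∉ K ∧ Metric.infDist (zcast γ) (θ.submodule : Set (Fin d → ℝ)) < ε ∧
      0 < μ (B ∩ T γ '' B) := by
  obtain ⟨i, hi⟩ := exists_coord_norm_le θ
  obtain ⟨C, hC⟩ := hK.isBounded.exists_norm_le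
  obtain ⟨n, hn⟩ := exists_nat_gt C
  obtain ⟨γ, hγ, v, hv, hdist, hμ⟩ := hrec.exists_le_coord hT hi n ε hε B hB hpos
  refine ⟨γ, fun hmem => ?_, ?_, hμ⟩
  · have h1 : |(γ i : ℝ)| ≤ C := (norm_le_pi_norm (zcast γ) i).trans (hC _ hmem)
    have h2 : (n : ℝ) ≤ (γ i : ℝ) := by exact_mod_cast hγ
    linarith [le_abs_self (γ i : ℝ)]
  · exact (Metric.infDist_le_dist_of_mem hv).trans_lt (by rwa [dist_eq_norm])

end Action

/-- Given countably many automorphisms `f n`, greedily choose pieces of `A` mapped into `A` with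
disjoint images, until no `f n` maps an unused point of `A` to an unused point of `A`. -/
theorem exists_greedy_exhaustion {X : Type*} [MeasurableSpace X] (f : ℕ → X ≃ᵐ X) {A : Set X}
    (hA : MeasurableSet A) :
    ∃ As : ℕ → Set X, (∀ i, MeasurableSet (As i)) ∧ (∀ i, As i ⊆ A) ∧
      Pairwise (Function.onFun Disjoint As) ∧ (∀ i, f i '' As i ⊆ A) ∧
      Pairwise (Function.onFun Disjoint fun i => f i '' As i) ∧
      ∀ n, ∀ x ∈ A \ ⋃ i, As i, f n x ∉ A \ ⋃ i, f i '' As i := by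
  let piece : ℕ → Set X × Set X → Set X := fun n p => (A \ p.1) ∩ f n ⁻¹' (A \ p.2)
  let used : ℕ → Set X × Set X := fun n =>
    Nat.rec (∅, ∅) (fun n p => (p.1 ∪ piece n p, p.2 ∪ f n '' piece n p)) n
  let As : ℕ → Set X := fun n => piece n (used n)
  have used_succ : ∀ n, used (n + 1) = ((used n).1 ∪ As n, (used n).2 ∪ f n '' As n) :=
    fun n => rfl
  have fst_used : ∀ n, (used n).1 = ⋃ k < n, As k := by
    intro n
    induction n with
    | zero => simp [used]
    | succ n ih => rw [used_succ, biUnion_lt_succ, ← ih]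
  have snd_used : ∀ n, (used n).2 = ⋃ k < n, f k '' As k := by
    intro n
    induction n with
    | zero => simp [used]
    | succ n ih => rw [used_succ, biUnion_lt_succ (fun k => f k '' As k), ← ih]
  have hmem : ∀ n x, x ∈ As n ↔
      (x ∈ A ∧ x ∉ ⋃ k < n, As k) ∧ f n x ∈ A ∧ f n x ∉ ⋃ k < n, f k '' As k := by
    intro n x
    rw [← fst_used, ← snd_used]
    rfl
  have hmeas : ∀ n, MeasurableSet (used n).1 ∧ MeasurableSet (used n).2 ∧
      MeasurableSet (As n) := by
    have hpiece : ∀ n, MeasurableSet (used n).1 → MeasurableSet (used n).2 →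
        MeasurableSet (As n) := fun n h1 h2 =>
      (hA.diff h1).inter ((f n).measurable (hA.diff h2))
    intro n
    induction n with
    | zero => exact ⟨.empty, .empty, hpiece 0 .empty .empty⟩
    | succ n ih =>
      have h1 : MeasurableSet (used (n + 1)).1 := ih.1.union ih.2.2
      have h2 : MeasurableSet (used (n + 1)).2 :=
        ih.2.1.union ((f n).measurableSet_image.mpr ih.2.2)
      exact ⟨h1, h2, hpiece (n + 1) h1 h2⟩
  refine ⟨As, fun i => (hmeas i).2.2, fun i x hx => ((hmem i x).mp hx).1.1, ?_, ?_, ?_, ?_⟩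
  · refine (pairwise_disjoint_on As).mpr fun m n hmn => disjoint_left.mpr fun x hm hn => ?_
    exact ((hmem n x).mp hn).1.2 (mem_biUnion (show m ∈ {k | k < n} from hmn) hm)
  · rintro i _ ⟨x, hx, rfl⟩
    exact ((hmem i x).mp hx).2.1
  · refine (pairwise_disjoint_on _).mpr fun m n hmn => disjoint_left.mpr ?_
    rintro _ hm ⟨x, hn, rfl⟩
    exact ((hmem n x).mp hn).2.2
      (mem_biUnion (t := fun k => f k '' As k) (show m ∈ {k | k < n} from hmn) hm)
  · rintro n x ⟨hxA, hx⟩ ⟨hfA, hf⟩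
    refine hx (mem_iUnion.mpr ⟨n, (hmem n x).mpr ⟨⟨hxA, fun h => hx ?_⟩, hfA, fun h => hf ?_⟩⟩)
    · exact iUnion₂_subset_iUnion _ _ h
    · exact iUnion₂_subset_iUnion _ _ h

/-- exhaustion lemma: if `T` is recurrent along `θ`, then for every `ε > 0`,
compact `K ⊂ ℝ^d` and set `A` of finite positive measure there are pairwise disjoint measurable
subsets `A_i ⊆ A` and `γ_i ∈ ℤ^d \ K` with `dist(γ_i, θ) < ε`, whose images `T_{γ_i} A_i` are
pairwise disjoint subsets of `A`, and `μ(⋃ A_i) ≥ μ(A)/2`. -/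
theorem exhaustion_of_recurrentAlong {X : Type*} [MeasurableSpace X] [StandardBorelSpace X]
    (μ : Measure X) [SigmaFinite μ] {d : ℕ} (hd : 1 ≤ d)
    (T : (Fin d → ℤ) → X ≃ᵐ X) (hT : IsMPAction μ T)
    (θ : Projectivization ℝ (Fin d → ℝ)) (hrec : RecurrentAlong μ T θ)
    (ε : ℝ) (hε : 0 < ε) (K : Set (Fin d → ℝ)) (hK : IsCompact K)
    (A : Set X) (hA : MeasurableSet A) (hApos : 0 < μ A) (hAfin : μ A < ⊤) :
    ∃ (As : ℕ → Set X) (γ : ℕ → Fin d → ℤ),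
      (∀ i, MeasurableSet (As i)) ∧ (∀ i, As i ⊆ A) ∧
      Pairwise (Function.onFun Disjoint As) ∧
      (∀ i, zcast (γ i) ∉ K) ∧
      (∀ i, Metric.infDist (zcast (γ i)) ((θ.submodule : Set (Fin d → ℝ))) < ε) ∧
      (∀ i, T (γ i) '' As i ⊆ A) ∧
      Pairwise (Function.onFun Disjoint fun i => T (γ i) '' As i) ∧
      μ A / 2 ≤ μ (⋃ i, As i) := by
  let good : Set (Fin d → ℤ) := {γ | zcast γ ∉ K ∧
    Metric.infDist (zcast γ) (θ.submodule : Set (Fin d → ℝ)) < ε}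
  have hgood : good.Nonempty := by
    obtain ⟨γ, hγK, hγθ, -⟩ := hrec.exists_notMem_isCompact hT hε hK hA hApos
    exact ⟨γ, hγK, hγθ⟩
  obtain ⟨γ, hγ⟩ := (to_countable good).exists_eq_range hgood
  have hγgood : ∀ i, γ i ∈ good := fun i => hγ ▸ mem_range_self i
  obtain ⟨As, hmeas, hsub, hdisj, himg, himgdisj, hmax⟩ :=
    exists_greedy_exhaustion (fun i => T (γ i)) hA
  refine ⟨As, γ, hmeas, hsub, hdisj, fun i => (hγgood i).1, fun i => (hγgood i).2, himg,
    himgdisj, ?_⟩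
  have himgmeas : ∀ i, MeasurableSet (T (γ i) '' As i) := fun i =>
    (T (γ i)).measurableSet_image.mpr (hmeas i)
  have heq : μ (⋃ i, T (γ i) '' As i) = μ (⋃ i, As i) := by
    rw [measure_iUnion himgdisj himgmeas, measure_iUnion hdisj hmeas]
    simp only [hT.measure_image]
  set U := ⋃ i, As i
  set V := ⋃ i, T (γ i) '' As i
  have hnull : μ (A \ (U ∪ V)) = 0 := by
    by_contra hne
    obtain ⟨δ, hδK, hδθ, hδμ⟩ := hrec.exists_notMem_isCompact hT hε hK
      (hA.diff ((MeasurableSet.iUnion hmeas).union (.iUnion himgmeas))) (pos_iff_ne_zero.mpr hne)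
    obtain ⟨n, rfl⟩ : δ ∈ range γ := hγ ▸ (⟨hδK, hδθ⟩ : δ ∈ good)
    obtain ⟨_, hy, x, hx, rfl⟩ := nonempty_of_measure_ne_zero hδμ.ne'
    exact hmax n x ⟨hx.1, fun h => hx.2 (.inl h)⟩ ⟨hy.1, fun h => hy.2 (.inr h)⟩
  by_contra! hlt
  have hle : μ A ≤ μ U + μ V :=
    calc μ A ≤ μ (A \ (U ∪ V) ∪ (U ∪ V)) := measure_mono (by simp)
      _ ≤ μ (A \ (U ∪ V)) + μ (U ∪ V) := measure_union_le _ _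
      _ ≤ μ U + μ V := by rw [hnull, zero_add]; exact measure_union_le _ _
  have := hle.trans_lt (ENNReal.add_lt_add hlt (heq.trans_lt hlt))
  rw [ENNReal.add_halves] at this
  exact this.false
end
end

section
/- Let d ≥ 1, let Δ be a G_δ-subset of the projective space P(ℝ^d), and let D be a countable subset of Δ. Then there exists a free measure preserving ℤ^d-action T on a σ-finite standard measure space (X, μ) with μ(X) = ∞ such that D ⊆ 𝓡(T) ⊆ Δ. -/
open MeasureTheory Filter Set Topology

noncomputable section

/-- Let `σ` be a measure preserving action of a countable group with a measurable transversal `F`.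
A `ℤ^d`-action commuting with `σ` induces a measure preserving `ℤ^d`-action on `F`. -/
theorem exists_action_on_transversal {d : ℕ} {Z : Type*} [MeasurableSpace Z] (ν : Measure Z)
    {Γ : Type*} [AddGroup Γ] [Countable Γ] (σ : Γ → Z → Z) (hσ0 : ∀ z, σ 0 z = z)
    (hσadd : ∀ s t z, σ (s + t) z = σ s (σ t z)) (hσ : ∀ s, MeasurePreserving (σ s) ν ν)
    (τ : (Fin d → ℤ) → Z → Z) (hτ0 : ∀ z, τ 0 z = z)
    (hτadd : ∀ γ γ' z, τ (γ + γ') z = τ γ (τ γ' z)) (hτ : ∀ γ, MeasurePreserving (τ γ) ν ν)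
    (hcomm : ∀ s γ z, τ γ (σ s z) = σ s (τ γ z)) {F : Set Z} (hF : MeasurableSet F)
    (hex : ∀ z, ∃! s, σ s z ∈ F) :
    ∃ T : (Fin d → ℤ) → F ≃ᵐ F, IsMPAction (ν.comap ((↑) : F → Z)) T ∧
      ∀ γ (p q : F), T γ p = q ↔ ∃ s, σ s (τ γ p) = q := by
  choose r hrF hr using hex
  let N : Z → F := fun z => ⟨σ (r z) z, hrF z⟩
  have hN : ∀ z (q : F), N z = q ↔ ∃ s, σ s z = q := by
    intro z q
    constructor
    · rintro rfl
      exact ⟨r z, rfl⟩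
    · rintro ⟨s, hs⟩
      have : s = r z := hr z s (by simp [hs])
      ext
      simp [N, ← this, hs]
  have hpre : ∀ B : Set F, N ⁻¹' B = ⋃ s, σ s ⁻¹' ((↑) '' B : Set Z) := by
    intro B
    ext z
    simp only [mem_preimage, mem_iUnion, mem_image]
    constructor
    · intro h
      exact ⟨r z, N z, h, rfl⟩
    · rintro ⟨s, q, hq, hs⟩
      rwa [(hN z q).2 ⟨s, hs.symm⟩]
  have himage : ∀ {B : Set F}, MeasurableSet B → MeasurableSet ((↑) '' B : Set Z) :=
    fun hB => hF.subtype_image hB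
  have hNm : Measurable N := by
    intro B hB
    rw [hpre]
    exact MeasurableSet.iUnion fun s => (hσ s).measurable (himage hB)
  have hNσ : ∀ s z, N (σ s z) = N z := by
    intro s z
    rw [hN]
    refine ⟨r z - s, ?_⟩
    rw [← hσadd, sub_add_cancel]
  let f : (Fin d → ℤ) → F → F := fun γ p => N (τ γ p)
  have hfadd : ∀ γ γ' p, f (γ + γ') p = f γ (f γ' p) := by
    intro γ γ' p
    change N (τ (γ + γ') p) = N (τ γ (σ (r (τ γ' p)) (τ γ' p)))
    rw [hcomm, hNσ, hτadd]
  have hf0 : ∀ p, f 0 p = p := by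
    intro p
    rw [hN]
    exact ⟨0, by rw [hσ0, hτ0]⟩
  have hfm : ∀ γ, Measurable (f γ) := fun γ =>
    hNm.comp ((hτ γ).measurable.comp measurable_subtype_coe)
  let : AddAction Γ Z := { vadd := σ, zero_vadd := hσ0, add_vadd := hσadd }
  have : MeasurableConstVAdd Γ Z := ⟨fun s => (hσ s).measurable⟩
  have : VAddInvariantMeasure Γ Z ν := ⟨fun s A hA => (hσ s).measure_preimage hA.nullMeasurableSet⟩
  have hdom : IsAddFundamentalDomain Γ F ν :=
    IsAddFundamentalDomain.mk' hF.nullMeasurableSet fun z => ⟨r z, hrF z, hr z⟩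
  have hdom' : ∀ γ, IsAddFundamentalDomain Γ (τ γ ⁻¹' F) ν := fun γ =>
    IsAddFundamentalDomain.mk' ((hτ γ).measurable hF).nullMeasurableSet fun z =>
      ⟨r (τ γ z), by
        change τ γ (σ _ z) ∈ F
        rw [hcomm]
        exact hrF _, fun s hs => hr _ s (by
        change τ γ (σ s z) ∈ F at hs
        rwa [hcomm] at hs)⟩
  refine ⟨fun γ => ⟨⟨f γ, f (-γ), fun p => ?_, fun p => ?_⟩, hfm γ, hfm (-γ)⟩,
    ⟨hfadd, fun γ => ⟨hfm γ, ?_⟩⟩, fun γ p q => hN _ _⟩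
  · rw [← hfadd, neg_add_cancel, hf0]
  · rw [← hfadd, add_neg_cancel, hf0]
  · ext B hB
    change (ν.comap ((↑) : F → Z)).map (f γ) B = _
    rw [Measure.map_apply (hfm γ) hB, comap_subtype_coe_apply hF, comap_subtype_coe_apply hF]
    have hinv : ∀ s : Γ, (fun z => s +ᵥ z) ⁻¹' (τ γ ⁻¹' (N ⁻¹' B)) = τ γ ⁻¹' (N ⁻¹' B) := by
      intro s
      ext z
      change N (τ γ (σ s z)) ∈ B ↔ N (τ γ z) ∈ B
      rw [hcomm, hNσ]
    have h1 : ((↑) '' (f γ ⁻¹' B) : Set Z) = τ γ ⁻¹' (N ⁻¹' B) ∩ F := by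
      ext z
      simp [f, and_comm]
    have h2 : ((↑) '' B : Set Z) = N ⁻¹' B ∩ F := by
      ext z
      simp only [mem_image, mem_inter_iff, mem_preimage]
      constructor
      · rintro ⟨q, hq, rfl⟩
        exact ⟨by rwa [(hN q q).2 ⟨0, hσ0 _⟩], q.2⟩
      · rintro ⟨hz, hzF⟩
        have := (hN z ⟨z, hzF⟩).2 ⟨0, hσ0 _⟩
        exact ⟨_, hz, by rw [this]⟩
    rw [h1, h2, hdom.measure_set_eq (hdom' γ) ((hτ γ).measurable (hNm hB)) hinv, ← preimage_inter,
      (hτ γ).measure_preimage ((hNm hB).inter hF).nullMeasurableSet]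

/-- The integer change of the coordinates of `x ∈ {0,1}^ι` when adding `s` modulo two,
with the sign of `x - (x + s)`. -/
def flipDiff {ι : Type*} (s : ι →₀ ZMod 2) (x : ι → ZMod 2) : ι →₀ ℤ :=
  Finsupp.onFinset s.support (fun i => ((x i).val : ℤ) - ((x i + s i).val : ℤ)) (by
    intro i hi
    rw [Finsupp.mem_support_iff]
    intro h
    simp [h] at hi)

theorem flipDiff_apply {ι : Type*} (s : ι →₀ ZMod 2) (x : ι → ZMod 2) (i : ι) :
    flipDiff s x i = ((x i).val : ℤ) - ((x i + s i).val : ℤ) := rfl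

theorem flipDiff_add {ι : Type*} (s t : ι →₀ ZMod 2) (x : ι → ZMod 2) :
    flipDiff (s + t) x = flipDiff s (x + t) + flipDiff t x := by
  ext i
  simp [flipDiff_apply, add_assoc, add_comm (s i)]

theorem abs_flipDiff_le {ι : Type*} (s : ι →₀ ZMod 2) (x : ι → ZMod 2) (i : ι) :
    |flipDiff s x i| ≤ 1 := by
  rw [flipDiff_apply]
  generalize x i = a
  generalize s i = b
  revert a b
  decide

theorem flipDiff_apply_eq_zero {ι : Type*} {s : ι →₀ ZMod 2} {x : ι → ZMod 2} {i : ι} :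
    flipDiff s x i = 0 ↔ s i = 0 := by
  rw [flipDiff_apply]
  generalize x i = a
  generalize s i = b
  revert a b
  decide

theorem flipDiff_eq_zero {ι : Type*} {s : ι →₀ ZMod 2} {x : ι → ZMod 2} :
    flipDiff s x = 0 ↔ s = 0 := by
  simp [Finsupp.ext_iff, flipDiff_apply_eq_zero]

/-- The displacement in `ℤ^d` produced by flipping the coordinates `s` of `x`. -/
def flipCocycle {ι : Type*} {d : ℕ} (c : ι → Fin d → ℤ) (s : ι →₀ ZMod 2) (x : ι → ZMod 2) :
    Fin d → ℤ :=
  Finsupp.linearCombination ℤ c (flipDiff s x)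

theorem flipCocycle_zero {ι : Type*} {d : ℕ} (c : ι → Fin d → ℤ) (x : ι → ZMod 2) :
    flipCocycle c 0 x = 0 := by
  simp [flipCocycle, flipDiff_eq_zero.2]

theorem flipCocycle_add {ι : Type*} {d : ℕ} (c : ι → Fin d → ℤ) (s t : ι →₀ ZMod 2)
    (x : ι → ZMod 2) :
    flipCocycle c (s + t) x = flipCocycle c s (x + t) + flipCocycle c t x := by
  simp [flipCocycle, flipDiff_add]

theorem flipCocycle_single {ι : Type*} {d : ℕ} (c : ι → Fin d → ℤ) (i : ι) {x : ι → ZMod 2}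
    (hx : x i = 0) : flipCocycle c (Finsupp.single i 1) x = -c i := by
  have : flipDiff (Finsupp.single i 1) x = Finsupp.single i (-1) := by
    ext j
    rw [flipDiff_apply]
    by_cases h : i = j
    · subst h
      simp [hx, ZMod.val_one]
    · simp [h]
  simp [flipCocycle, this]

theorem measurable_flipCocycle {ι : Type*} {d : ℕ} (c : ι → Fin d → ℤ) (s : ι →₀ ZMod 2) :
    Measurable (flipCocycle c s) := by
  have h : flipCocycle c s =
      fun x => ∑ i ∈ s.support, (((x i).val : ℤ) - ((x i + s i).val : ℤ)) • c i := by
    ext1 x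
    rw [flipCocycle, Finsupp.linearCombination_apply, flipDiff, Finsupp.onFinset_sum]
    simp
  rw [h, measurable_pi_iff]
  intro j
  simp only [Finset.sum_apply, Pi.smul_apply]
  refine Finset.measurable_sum _ fun i _ => ?_
  exact (measurable_of_countable
    fun a : ZMod 2 => ((a.val : ℤ) - ((a + s i).val : ℤ)) • c i j).comp (measurable_pi_apply i)

/-- Flipping coordinates, as a transformation of `{0,1}^ι × (ℤ^d × ℤ)`. -/
def flipMap {ι : Type*} {d : ℕ} (c : ι → Fin d → ℤ) (s : ι →₀ ZMod 2)
    (z : (ι → ZMod 2) × ((Fin d → ℤ) × ℤ)) : (ι → ZMod 2) × ((Fin d → ℤ) × ℤ) :=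
  (⇑s + z.1, (flipCocycle c s z.1, 0) + z.2)

/-- The translations of the second factor of `{0,1}^ι × (ℤ^d × ℤ)`. -/
def shiftMap {ι : Type*} {d : ℕ} (γ : Fin d → ℤ)
    (z : (ι → ZMod 2) × ((Fin d → ℤ) × ℤ)) : (ι → ZMod 2) × ((Fin d → ℤ) × ℤ) :=
  (z.1, (γ, 0) + z.2)

/-- The product of Haar measure and counting measure on `{0,1}^ι × (ℤ^d × ℤ)`. -/
def skewMeasure (ι : Type*) [Countable ι] (d : ℕ) :
    Measure ((ι → ZMod 2) × ((Fin d → ℤ) × ℤ)) :=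
  (Measure.addHaar : Measure (ι → ZMod 2)).prod Measure.count

instance (ι : Type*) [Countable ι] (d : ℕ) : SigmaFinite (skewMeasure ι d) :=
  inferInstanceAs (SigmaFinite ((Measure.addHaar : Measure (ι → ZMod 2)).prod Measure.count))

theorem flipMap_add {ι : Type*} {d : ℕ} (c : ι → Fin d → ℤ) (s t : ι →₀ ZMod 2)
    (z : (ι → ZMod 2) × ((Fin d → ℤ) × ℤ)) :
    flipMap c (s + t) z = flipMap c s (flipMap c t z) := by
  ext <;> simp [flipMap, flipCocycle_add, add_assoc, add_comm z.1]

theorem measurePreserving_flipMap {ι : Type*} [Countable ι] {d : ℕ} (c : ι → Fin d → ℤ)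
    (s : ι →₀ ZMod 2) : MeasurePreserving (flipMap c s) (skewMeasure ι d) (skewMeasure ι d) := by
  refine (measurePreserving_add_left (Measure.addHaar : Measure (ι → ZMod 2)) ⇑s).skew_product
    (g := fun x b => (flipCocycle c s x, (0 : ℤ)) + b) ?_
    (Eventually.of_forall fun x => map_add_left_eq_self _ _)
  exact (((measurable_flipCocycle c s).comp measurable_fst).prodMk measurable_const).add
    measurable_snd

theorem measurePreserving_shiftMap {ι : Type*} [Countable ι] {d : ℕ} (γ : Fin d → ℤ) :
    MeasurePreserving (shiftMap γ) (skewMeasure ι d) (skewMeasure ι d) :=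
  (MeasurePreserving.id _).prod (measurePreserving_add_left Measure.count (γ, (0 : ℤ)))

/-- The points whose `ℤ^d`-coordinate comes first, in the enumeration `idx`, among those of all
points obtained by flipping coordinates. -/
def transversal {ι : Type*} {d : ℕ} (c : ι → Fin d → ℤ) (idx : (Fin d → ℤ) → ℕ) :
    Set ((ι → ZMod 2) × ((Fin d → ℤ) × ℤ)) :=
  {z | ∀ s, idx z.2.1 ≤ idx (flipMap c s z).2.1}

theorem measurableSet_transversal {ι : Type*} [Countable ι] {d : ℕ} (c : ι → Fin d → ℤ)
    (idx : (Fin d → ℤ) → ℕ) : MeasurableSet (transversal c idx) := by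
  have hidx : Measurable idx := measurable_of_countable _
  rw [transversal, ofPred_forall]
  refine MeasurableSet.iInter fun s => measurableSet_le ?_ ?_
  · exact hidx.comp (measurable_fst.comp measurable_snd)
  · exact hidx.comp (measurable_fst.comp
      (measurable_snd.comp (measurePreserving_flipMap c s).measurable))

theorem existsUnique_flipMap_mem_transversal {ι : Type*} {d : ℕ} {c : ι → Fin d → ℤ}
    (hc : ∀ e : ι →₀ ℤ, (∀ i, |e i| ≤ 1) → e ≠ 0 → Finsupp.linearCombination ℤ c e ≠ 0)
    {idx : (Fin d → ℤ) → ℕ} (hidx : idx.Injective) (z : (ι → ZMod 2) × ((Fin d → ℤ) × ℤ)) :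
    ∃! s, flipMap c s z ∈ transversal c idx := by
  obtain ⟨s, hs⟩ : ∃ s, ∀ t, idx (flipMap c s z).2.1 ≤ idx (flipMap c t z).2.1 :=
    ⟨_, fun t => Function.argmin_le (fun s => idx (flipMap c s z).2.1) t⟩
  refine ⟨s, fun t => by rw [← flipMap_add]; exact hs _, fun t ht => ?_⟩
  have h1 : idx (flipMap c t z).2.1 = idx (flipMap c s z).2.1 := by
    refine le_antisymm ?_ (hs t)
    have := ht (s - t)
    rwa [← flipMap_add, sub_add_cancel] at this
  have h2 : flipCocycle c t z.1 = flipCocycle c s z.1 := by simpa [flipMap] using hidx h1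
  obtain ⟨r, rfl⟩ : ∃ r, t = r + s := ⟨t - s, by simp⟩
  rw [flipCocycle_add, add_eq_right] at h2
  by_contra h
  refine hc _ (abs_flipDiff_le r _) (fun h0 => h ?_) h2
  rw [flipDiff_eq_zero.1 h0, zero_add]

theorem eventually_addHaar_flip_pos {ι : Type*} [Countable ι] {A : Set (ι → ZMod 2)}
    (hA : MeasurableSet A) (hpos : 0 < (Measure.addHaar : Measure (ι → ZMod 2)) A) :
    ∀ᶠ i in cofinite, 0 < (Measure.addHaar : Measure (ι → ZMod 2))
      {x | x ∈ A ∧ ⇑(Finsupp.single i (1 : ZMod 2)) + x ∈ A ∧ x i = 1} := by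
  set m : Measure (ι → ZMod 2) := Measure.addHaar
  let e : ι → ι → ZMod 2 := fun i => ⇑(Finsupp.single i (1 : ZMod 2))
  have hee : ∀ i x, e i + (e i + x) = x := by
    intro i x
    rw [← add_assoc]
    have : e i + e i = 0 := by
      ext j
      exact CharTwo.add_self_eq_zero _
    rw [this, zero_add]
  have hmp : ∀ i, MeasurePreserving (e i + ·) m m := fun i => measurePreserving_add_left m (e i)
  let B : ι → Set (ι → ZMod 2) := fun i => A ∩ (e i + ·) ⁻¹' A
  have hB : ∀ i, MeasurableSet (B i) := fun i => hA.inter ((hmp i).measurable hA)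
  have hlim : Tendsto e cofinite (𝓝 0) := by
    rw [tendsto_pi_nhds]
    intro j
    refine tendsto_nhds_of_eventually_eq ?_
    filter_upwards [(finite_singleton j).compl_mem_cofinite] with i hi
    have : i ≠ j := hi
    simp [e, this]
  have hBpos : ∀ᶠ i in cofinite, 0 < m (B i) := by
    let A' := A \ ⋃ i ∈ {i | m (B i) = 0}, B i
    have hA' : MeasurableSet A' :=
      hA.diff (MeasurableSet.biUnion (to_countable _) fun i _ => hB i)
    have hA'pos : 0 < m A' := by
      have hnull : m (⋃ i ∈ {i | m (B i) = 0}, B i) = 0 :=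
        (measure_biUnion_null_iff (to_countable _)).2 fun i hi => hi
      rwa [measure_sdiff_null hnull]
    filter_upwards [hlim (Measure.sub_mem_nhds_zero_of_addHaar_pos m A' hA' hA'pos)] with i hi
    obtain ⟨a, ha, b, hb, hab⟩ := hi
    rw [pos_iff_ne_zero]
    intro h0
    refine hb.2 (mem_biUnion (show i ∈ {i | m (B i) = 0} from h0) ⟨hb.1, ?_⟩)
    have : e i + b = a := by rw [← hab]; simp
    simpa [this] using ha.1
  filter_upwards [hBpos] with i hi
  set W := {x | x ∈ A ∧ ⇑(Finsupp.single i (1 : ZMod 2)) + x ∈ A ∧ x i = 1} with hW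
  have hWm : MeasurableSet W := by
    have : W = B i ∩ (fun x => x i) ⁻¹' {1} := by
      ext x
      exact and_assoc.symm
    rw [this]
    exact (hB i).inter (measurable_pi_apply i (measurableSet_singleton 1))
  have hsub : B i ⊆ W ∪ (e i + ·) ⁻¹' W := by
    intro x hx
    have h01 : ∀ a : ZMod 2, a = 1 ∨ 1 + a = 1 := by decide
    rcases h01 (x i) with h | h
    · exact Or.inl ⟨hx.1, hx.2, h⟩
    · refine Or.inr ⟨hx.2, ?_, by simpa [e] using h⟩
      change e i + (e i + x) ∈ A
      rw [hee]
      exact hx.1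
  rw [pos_iff_ne_zero]
  intro h0
  refine hi.ne' (measure_mono_null hsub (measure_union_null h0 ?_))
  rw [(hmp i).measure_preimage hWm.nullMeasurableSet, h0]

/-- The action defined by a family `c` of independent vectors is free and infinite measure
preserving. It is recurrent along the lines approached by `c`, and not recurrent along the lines
which stay away from the signed sums of all but finitely many members of `c`. -/
theorem exists_action_of_signed_sums {d : ℕ} {ι : Type} [Countable ι] (c : ι → Fin d → ℤ)
    (hc : ∀ e : ι →₀ ℤ, (∀ i, |e i| ≤ 1) → e ≠ 0 → Finsupp.linearCombination ℤ c e ≠ 0) :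
    ∃ (X : Type) (_ : MeasurableSpace X), StandardBorelSpace X ∧
      ∃ μ : Measure X, SigmaFinite μ ∧ μ Set.univ = ⊤ ∧
        ∃ T : (Fin d → ℤ) → X ≃ᵐ X, IsMPAction μ T ∧ IsFreeAction μ T ∧
          (∀ θ : Projectivization ℝ (Fin d → ℝ),
            (∀ ε > 0, {i | ∃ v ∈ θ.submodule, ‖zcast (c i) - v‖ < ε}.Infinite) →
              θ ∈ recSet μ T) ∧
          ∀ (θ : Projectivization ℝ (Fin d → ℝ)) (K : Finset ι),
            (∀ e : ι →₀ ℤ, (∀ i, |e i| ≤ 1) → e ≠ 0 → (∀ i ∈ K, e i = 0) →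
              ∀ v ∈ θ.submodule, 1 ≤ ‖zcast (Finsupp.linearCombination ℤ c e) - v‖) →
              θ ∉ recSet μ T := by
  obtain ⟨idx, hidx⟩ := exists_injective_nat (Fin d → ℤ)
  obtain ⟨g, hg⟩ : ∃ g, ∀ g', idx g ≤ idx g' := ⟨_, fun t => Function.argmin_le idx t⟩
  set F := transversal c idx
  have hF : MeasurableSet F := measurableSet_transversal c idx
  have hgF : ∀ x k, (x, (g, k)) ∈ F := fun x k s => hg _
  obtain ⟨T, hT, hTiff⟩ := exists_action_on_transversal (skewMeasure ι d) (flipMap c)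
    (fun z => by ext <;> simp [flipMap, flipCocycle_zero]) (flipMap_add c)
    (measurePreserving_flipMap c) shiftMap (fun z => by ext <;> simp [shiftMap])
    (fun γ γ' z => by ext <;> simp [shiftMap, add_assoc]) measurePreserving_shiftMap
    (fun s γ z => by ext <;> simp [shiftMap, flipMap, add_left_comm]) hF
    (existsUnique_flipMap_mem_transversal hc hidx)
  have hμ : ∀ A : Set F, ((skewMeasure ι d).comap ((↑) : F → _)) A = skewMeasure ι d ((↑) '' A) :=
    fun A => comap_subtype_coe_apply hF _ A
  have hprod : ∀ (A : Set (ι → ZMod 2)) (B : Set ((Fin d → ℤ) × ℤ)),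
      skewMeasure ι d (A ×ˢ B) = Measure.addHaar A * Measure.count B := fun A B =>
    Measure.prod_prod A B
  refine ⟨F, inferInstance, hF.standardBorel, (skewMeasure ι d).comap (↑), ?_, ?_, T, hT,
    ?_, ?_, ?_⟩
  · refine SigmaFinite.of_map _ measurable_subtype_coe.aemeasurable ?_
    rw [map_comap_subtype_coe hF]
    infer_instance
  · rw [hμ, image_univ, Subtype.range_coe, eq_top_iff]
    have hsub : (univ : Set (ι → ZMod 2)) ×ˢ (range fun k : ℤ => (g, k)) ⊆ F := by
      rintro ⟨x, b⟩ ⟨-, k, rfl⟩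
      exact hgF x k
    refine le_trans (le_of_eq ?_) (measure_mono hsub)
    rw [hprod, Measure.count_apply_infinite, ENNReal.mul_top]
    · exact (isOpen_univ.measure_pos _ univ_nonempty).ne'
    · exact infinite_range_of_injective fun a b h => by simpa using h
  · intro γ hγ
    refine Eventually.of_forall fun p hp => hγ ?_
    obtain ⟨s, hs⟩ := (hTiff γ p p).1 hp
    have hs0 : s = 0 := by
      have h := congrArg Prod.fst hs
      simpa [flipMap, shiftMap] using h
    subst hs0
    have h := congrArg (fun z => z.2.1) hs
    simpa [flipMap, shiftMap, flipCocycle_zero] using h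
  · intro θ hθ ε hε A hA hpos
    set A₀ : Set ((ι → ZMod 2) × ((Fin d → ℤ) × ℤ)) := (↑) '' A with hA₀
    have hA0 : MeasurableSet A₀ := hF.subtype_image hA
    obtain ⟨b, hb⟩ : ∃ b, 0 < (Measure.addHaar : Measure (ι → ZMod 2))
        ((fun x => (x, b)) ⁻¹' A₀) := by
      by_contra! h
      rw [hμ, ← hA₀, skewMeasure, Measure.prod_apply_symm hA0] at hpos
      simp [fun b => nonpos_iff_eq_zero.1 (h b)] at hpos
    have hAb : MeasurableSet ((fun x : ι → ZMod 2 => (x, b)) ⁻¹' A₀) :=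
      measurable_prodMk_right hA0
    obtain ⟨i, ⟨v, hv, hvε⟩, hi⟩ := ((frequently_cofinite_iff_infinite.2 (hθ ε hε)).and_eventually
      (eventually_addHaar_flip_pos hAb hb)).exists
    refine ⟨c i, ?_, v, hv, hvε, ?_⟩
    · have h := hc (Finsupp.single i 1) (fun j => ?_) (by simp)
      · simpa using h
      · by_cases hij : i = j <;> simp [hij]
    · rw [hμ]
      set W := {x | x ∈ (fun x : ι → ZMod 2 => (x, b)) ⁻¹' A₀ ∧
        ⇑(Finsupp.single i (1 : ZMod 2)) + x ∈ (fun x : ι → ZMod 2 => (x, b)) ⁻¹' A₀ ∧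
          x i = 1} with hW
      have hsub : W ×ˢ {b} ⊆ (↑) '' (A ∩ T (c i) '' A) := by
        rintro ⟨x, b'⟩ ⟨⟨⟨p, hp, hpx⟩, ⟨q, hq, hqx⟩, hx⟩, rfl⟩
        refine ⟨p, ⟨hp, q, hq, (hTiff _ _ _).2 ⟨Finsupp.single i 1, ?_⟩⟩, hpx⟩
        dsimp only at hpx hqx hx
        rw [hpx, hqx]
        have h0 : (⇑(Finsupp.single i (1 : ZMod 2)) + x) i = 0 := by
          simp only [Pi.add_apply, Finsupp.single_eq_same, hx]
          decide
        have h1 : ⇑(Finsupp.single i (1 : ZMod 2)) + (⇑(Finsupp.single i (1 : ZMod 2)) + x)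
            = x := by
          rw [← add_assoc, add_eq_right]
          ext j
          exact CharTwo.add_self_eq_zero _
        have h2 := flipCocycle_single c i h0
        ext : 1
        · exact h1
        · change (flipCocycle c _ (⇑(Finsupp.single i (1 : ZMod 2)) + x), (0 : ℤ)) +
            ((c i, 0) + b') = b'
          rw [h2]
          ext <;> simp
      refine lt_of_lt_of_le ?_ (measure_mono hsub)
      rw [hprod, Measure.count_singleton, mul_one]
      exact hi
  · intro θ K hK hθ
    let U : Set (ι → ZMod 2) := (K : Set ι).pi fun _ => {0}
    have hU : IsOpen U := isOpen_set_pi K.finite_toSet fun _ _ => isOpen_discrete _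
    let A : Set F := (↑) ⁻¹' (U ×ˢ ({(g, 0)} : Set ((Fin d → ℤ) × ℤ)))
    have hA : MeasurableSet A :=
      measurable_subtype_coe (hU.measurableSet.prod (measurableSet_singleton _))
    have hApos : 0 < ((skewMeasure ι d).comap ((↑) : F → _)) A := by
      have himage : ((↑) '' A : Set ((ι → ZMod 2) × ((Fin d → ℤ) × ℤ))) = U ×ˢ {(g, 0)} := by
        rw [Subtype.image_preimage_coe, inter_eq_right]
        rintro ⟨x, b⟩ ⟨-, rfl⟩
        exact hgF x 0
      rw [hμ, himage, hprod, Measure.count_singleton, mul_one]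
      exact hU.measure_pos _ ⟨0, fun i _ => rfl⟩
    obtain ⟨γ, hγ, v, hv, hlt, hpos⟩ := hθ 1 one_pos A hA hApos
    obtain ⟨q, hq, p, hp, hpq⟩ := nonempty_of_measure_ne_zero hpos.ne'
    obtain ⟨s, hs⟩ := (hTiff γ p q).1 hpq
    have hp2 : p.1.2 = (g, 0) := hp.2
    have hq2 : q.1.2 = (g, 0) := hq.2
    have hγs : γ = -flipCocycle c s p.1.1 := by
      have h := congrArg (fun z => z.2.1) hs
      simp only [flipMap, shiftMap, hp2, hq2] at h
      rw [eq_neg_iff_add_eq_zero, add_comm]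
      simpa [← add_assoc] using h
    have hsK : ∀ i ∈ K, flipDiff s p.1.1 i = 0 := by
      intro i hi
      rw [flipDiff_apply_eq_zero]
      have h := congrFun (congrArg Prod.fst hs) i
      have hp0 : p.1.1 i = 0 := hp.1 i hi
      have hq0 : q.1.1 i = 0 := hq.1 i hi
      simpa [flipMap, shiftMap, hp0, hq0] using h
    have hne : flipDiff s p.1.1 ≠ 0 := by
      intro h0
      apply hγ
      rw [hγs, flipCocycle, h0, map_zero, neg_zero]
    have h1 := hK _ (abs_flipDiff_le s p.1.1) hne hsK (-v) (neg_mem hv)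
    refine absurd hlt (not_lt.2 (h1.trans_eq ?_))
    rw [← norm_neg]
    refine congrArg norm (funext fun j => ?_)
    simp [hγs, zcast, flipCocycle]
    ring

theorem zcast_linearCombination {ι : Type*} {d : ℕ} (c : ι → Fin d → ℤ) (e : ι →₀ ℤ) :
    zcast (Finsupp.linearCombination ℤ c e) = ∑ i ∈ e.support, (e i : ℝ) • zcast (c i) := by
  ext j
  simp [zcast, Finsupp.linearCombination_apply, Finsupp.sum]

/-- Multiples of a vector come arbitrarily close to the integer lattice. -/
theorem exists_norm_zcast_sub_smul_lt {d : ℕ} (w : Fin d → ℝ) {M ε : ℝ} (hM : 0 < M)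
    (hε : 0 < ε) : ∃ t ≥ M, ∃ γ : Fin d → ℤ, ‖zcast γ - t • w‖ < ε := by
  let a : ℕ → Fin d → ℝ := fun k j => Int.fract (k * M * w j)
  have ha : ∀ k, a k ∈ Icc (0 : Fin d → ℝ) 1 := fun k =>
    ⟨fun j => Int.fract_nonneg _, fun j => (Int.fract_lt_one _).le⟩
  obtain ⟨b, -, φ, hφ, hlim⟩ := isCompact_Icc.tendsto_subseq ha
  obtain ⟨N, hN⟩ := Metric.cauchySeq_iff.1 hlim.cauchySeq ε hε
  have hlt : φ N < φ (N + 1) := hφ N.lt_succ_self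
  refine ⟨((φ (N + 1) : ℝ) - φ N) * M, ?_,
    fun j => ⌊φ (N + 1) * M * w j⌋ - ⌊φ N * M * w j⌋, ?_⟩
  · have : (φ N : ℝ) + 1 ≤ φ (N + 1) := by exact_mod_cast hlt
    nlinarith
  · have h := hN N le_rfl (N + 1) N.le_succ
    rw [dist_eq_norm] at h
    refine lt_of_eq_of_lt (congrArg norm (funext fun j => ?_)) h
    simp only [zcast, a, Function.comp, Pi.sub_apply, Pi.smul_apply, smul_eq_mul, Int.fract,
      Int.cast_sub]
    ring

/-- The union of `0` and the lines which are not in `U`. -/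
def coneCompl {d : ℕ} (U : Set (Projectivization ℝ (Fin d → ℝ))) : Set (Fin d → ℝ) :=
  {v | ∀ h : v ≠ 0, Projectivization.mk ℝ v h ∉ U}

theorem smul_mem_coneCompl {d : ℕ} {U : Set (Projectivization ℝ (Fin d → ℝ))} {v : Fin d → ℝ}
    (hv : v ∈ coneCompl U) (t : ℝ) : t • v ∈ coneCompl U := by
  intro h
  have hv0 : v ≠ 0 := right_ne_zero_of_smul h
  rw [(Projectivization.mk_eq_mk_iff' ℝ (t • v) v h hv0).2 ⟨t, rfl⟩]
  exact hv hv0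

theorem mem_coneCompl_of_mem_submodule {d : ℕ} {U : Set (Projectivization ℝ (Fin d → ℝ))}
    {θ : Projectivization ℝ (Fin d → ℝ)} (hθ : θ ∉ U) {v : Fin d → ℝ} (hv : v ∈ θ.submodule) :
    v ∈ coneCompl U := by
  intro h
  rw [Projectivization.submodule_eq, Submodule.mem_span_singleton] at hv
  rwa [(Projectivization.mk_eq_mk_iff' ℝ v θ.rep h θ.rep_nonzero).2 hv, Projectivization.mk_rep]

theorem coneCompl_anti {d : ℕ} {U V : Set (Projectivization ℝ (Fin d → ℝ))} (h : U ⊆ V) :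
    coneCompl V ⊆ coneCompl U :=
  fun _ hv h0 hU => hv h0 (h hU)

theorem isClosed_coneCompl {d : ℕ} {U : Set (Projectivization ℝ (Fin d → ℝ))} (hU : IsOpen U) :
    IsClosed (coneCompl U) := by
  have hcont : Continuous (Projectivization.mk' ℝ : {v : Fin d → ℝ // v ≠ 0} → _) :=
    continuous_quotient_mk'
  have hopen : IsOpen ((↑) '' (Projectivization.mk' ℝ ⁻¹' U) : Set (Fin d → ℝ)) :=
    isOpen_ne.isOpenMap_subtype_val _ (hU.preimage hcont)
  convert hopen.isClosed_compl using 1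
  ext v
  simp [coneCompl, Projectivization.mk'_eq_mk]

/-- There are integer vectors close to a given line of an open set `U`, and far from all lines
which are not in `U`. -/
theorem exists_zcast_near_line {d : ℕ} {U : Set (Projectivization ℝ (Fin d → ℝ))} (hU : IsOpen U)
    {θ : Projectivization ℝ (Fin d → ℝ)} (hθ : θ ∈ U) (R : ℝ) {ε : ℝ} (hε : 0 < ε) :
    ∃ γ : Fin d → ℤ, (∃ w ∈ θ.submodule, ‖zcast γ - w‖ < ε) ∧
      ∀ v ∈ coneCompl U, R ≤ ‖zcast γ - v‖ := by
  have hw : θ.rep ∉ coneCompl U := fun h => h θ.rep_nonzero (by rwa [Projectivization.mk_rep])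
  obtain ⟨r, hr, hball⟩ :=
    Metric.isOpen_iff.1 (isClosed_coneCompl hU).isOpen_compl θ.rep hw
  obtain ⟨t, ht, γ, hγ⟩ := exists_norm_zcast_sub_smul_lt θ.rep
    (show 0 < max 1 ((R + ε) / r) by positivity) hε
  have ht0 : 0 < t := one_pos.trans_le ((le_max_left _ _).trans ht)
  have htr : R + ε ≤ t * r := (div_le_iff₀ hr).1 ((le_max_right _ _).trans ht)
  refine ⟨γ, ⟨t • θ.rep, Submodule.smul_mem _ _ ?_, hγ⟩, fun v hv => ?_⟩
  · rw [Projectivization.submodule_eq]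
    exact Submodule.mem_span_singleton_self _
  · have h1 : r ≤ ‖t⁻¹ • v - θ.rep‖ := by
      by_contra! h
      exact hball (mem_ball_iff_norm.2 h) (smul_mem_coneCompl hv t⁻¹)
    have h2 : t * r ≤ ‖t • θ.rep - v‖ := by
      calc t * r ≤ t * ‖t⁻¹ • v - θ.rep‖ := by gcongr
        _ = ‖t • (t⁻¹ • v - θ.rep)‖ := by rw [norm_smul, Real.norm_of_nonneg ht0.le]
        _ = ‖t • θ.rep - v‖ := by rw [smul_sub, smul_inv_smul₀ ht0.ne', norm_sub_rev]
    have h3 : ‖t • θ.rep - v‖ ≤ ‖zcast γ - v‖ + ‖zcast γ - t • θ.rep‖ := by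
      rw [norm_sub_rev (zcast γ) (t • θ.rep), add_comm]
      exact norm_sub_le_norm_sub_add_norm_sub _ _ _
    linarith

/-- If each term of a sequence is further from a cone than the sum of the norms of the previous
terms, the signed sums are far from the cone. -/
theorem one_le_norm_zcast_linearCombination_sub {d : ℕ} {c : ℕ → Fin d → ℤ}
    {S : ℕ → Set (Fin d → ℝ)} (hS : Monotone S) (hsmul : ∀ n, ∀ v ∈ S n, ∀ t : ℝ, t • v ∈ S n)
    (hfar : ∀ n, ∀ v ∈ S n, 1 + ∑ k ∈ Finset.range n, ‖zcast (c k)‖ ≤ ‖zcast (c n) - v‖)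
    {e : ℕ →₀ ℤ} (he : ∀ i, |e i| ≤ 1) (he0 : e ≠ 0) {m : ℕ} (hm : ∀ i < m, e i = 0)
    {v : Fin d → ℝ} (hv : v ∈ S m) :
    1 ≤ ‖zcast (Finsupp.linearCombination ℤ c e) - v‖ := by
  have hne : e.support.Nonempty := Finsupp.support_nonempty_iff.2 he0
  set n := e.support.max' hne
  have hns : n ∈ e.support := Finset.max'_mem _ _
  have hen : e n ≠ 0 := Finsupp.mem_support_iff.1 hns
  have hmn : m ≤ n := not_lt.1 fun h => hen (hm n h)
  have hen' : e n = 1 ∨ e n = -1 := by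
    have := abs_le.1 (he n)
    omega
  have hsq : (e n : ℝ) * e n = 1 := by rcases hen' with h | h <;> simp [h]
  have habs : ∀ i, ‖(e i : ℝ)‖ ≤ 1 := fun i => by
    rw [Real.norm_eq_abs]
    exact_mod_cast he i
  have hrest : ‖∑ i ∈ e.support.erase n, (e i : ℝ) • zcast (c i)‖ ≤
      ∑ k ∈ Finset.range n, ‖zcast (c k)‖ := by
    refine (norm_sum_le _ _).trans ((Finset.sum_le_sum fun i _ => ?_).trans
      (Finset.sum_le_sum_of_subset_of_nonneg ?_ fun i _ _ => norm_nonneg _))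
    · rw [norm_smul]
      exact mul_le_of_le_one_left (norm_nonneg _) (habs i)
    · intro i hi
      rw [Finset.mem_erase] at hi
      exact Finset.mem_range.2 (lt_of_le_of_ne (Finset.le_max' _ _ hi.2) hi.1)
  have h1 := hfar n ((e n : ℝ) • v) (hsmul n v (hS hmn hv) _)
  have h2 : ‖zcast (c n) - (e n : ℝ) • v‖ ≤ ‖(e n : ℝ) • zcast (c n) - v‖ := by
    have : zcast (c n) - (e n : ℝ) • v = (e n : ℝ) • ((e n : ℝ) • zcast (c n) - v) := by
      rw [smul_sub, smul_smul, hsq, one_smul]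
    rw [this, norm_smul]
    exact mul_le_of_le_one_left (norm_nonneg _) (habs n)
  rw [zcast_linearCombination, ← Finset.add_sum_erase _ _ hns, add_sub_right_comm]
  have h3 := norm_sub_le_norm_add ((e n : ℝ) • zcast (c n) - v)
    (∑ i ∈ e.support.erase n, (e i : ℝ) • zcast (c i))
  linarith

theorem exists_seq_near_lines {d : ℕ} {O : ℕ → Set (Projectivization ℝ (Fin d → ℝ))}
    (hO : ∀ n, IsOpen (O n)) {θ : ℕ → Projectivization ℝ (Fin d → ℝ)} (hθ : ∀ n, θ n ∈ O n) :
    ∃ c : ℕ → Fin d → ℤ,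
      (∀ n, ∃ w ∈ (θ n).submodule, ‖zcast (c n) - w‖ < 1 / ((n : ℝ) + 1)) ∧
      ∀ n, ∀ v ∈ coneCompl (O n),
        1 + ∑ k ∈ Finset.range n, ‖zcast (c k)‖ ≤ ‖zcast (c n) - v‖ := by
  choose f hfθ hfO using fun n R =>
    exists_zcast_near_line (hO n) (hθ n) R (Nat.one_div_pos_of_nat (α := ℝ) (n := n))
  let u : ℕ → ℝ := fun n => Nat.rec 1 (fun n R => R + ‖zcast (f n R)‖) n
  have hu : ∀ n, u n = 1 + ∑ k ∈ Finset.range n, ‖zcast (f k (u k))‖ := by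
    intro n
    induction n with
    | zero => simp [u]
    | succ n ih => rw [Finset.sum_range_succ, ← add_assoc, ← ih]
  exact ⟨fun n => f n (u n), fun n => hfθ n _, fun n v hv => (hu n).symm.trans_le (hfO n _ v hv)⟩

/-- for every `G_δ`-subset `Δ` of `P(ℝ^d)` and every countable `D ⊆ Δ` there is a
free infinite measure preserving `ℤ^d`-action `T` with `D ⊆ 𝓡(T) ⊆ Δ`. -/
theorem realization_of_recurrence_sets {d : ℕ} (hd : 1 ≤ d)
    (Δ : Set (Projectivization ℝ (Fin d → ℝ))) (hΔ : IsGδ Δ)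
    (D : Set (Projectivization ℝ (Fin d → ℝ))) (hDc : D.Countable) (hDΔ : D ⊆ Δ) :
    ∃ (X : Type) (_ : MeasurableSpace X), StandardBorelSpace X ∧
      ∃ μ : Measure X, SigmaFinite μ ∧ μ Set.univ = ⊤ ∧
        ∃ T : (Fin d → ℤ) → X ≃ᵐ X, IsMPAction μ T ∧ IsFreeAction μ T ∧
          D ⊆ recSet μ T ∧ recSet μ T ⊆ Δ := by
  rcases D.eq_empty_or_nonempty with rfl | hD
  · obtain ⟨X, mX, hX, μ, hμ, hμX, T, hT, hfree, -, hrec⟩ :=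
      exists_action_of_signed_sums (d := d) (ι := Empty) (fun i => i.elim)
        fun e _ he => absurd (Subsingleton.elim e 0) he
    exact ⟨X, mX, hX, μ, hμ, hμX, T, hT, hfree, empty_subset _, fun θ hθ =>
      absurd hθ (hrec θ ∅ fun e _ he => absurd (Subsingleton.elim e 0) he)⟩
  obtain ⟨O, hO, rfl⟩ := hΔ.eq_iInter_nat
  obtain ⟨f, rfl⟩ := hDc.exists_eq_range hD
  let U : ℕ → Set (Projectivization ℝ (Fin d → ℝ)) := fun n => ⋂ k ∈ Iic n, O k
  have hU : ∀ n, IsOpen (U n) := fun n => (finite_Iic n).isOpen_biInter fun k _ => hO k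
  have hUanti : Antitone U := fun m n hmn => biInter_subset_biInter_left (Iic_subset_Iic.2 hmn)
  have hDU : ∀ a n, f a ∈ U n := fun a n =>
    mem_iInter₂.2 fun k _ => mem_iInter.1 (hDΔ (mem_range_self a)) k
  obtain ⟨c, hcθ, hcfar⟩ :=
    exists_seq_near_lines hU (θ := fun n => f n.unpair.1) fun n => hDU _ n
  have hsum : ∀ e : ℕ →₀ ℤ, (∀ i, |e i| ≤ 1) → e ≠ 0 → ∀ m, (∀ i < m, e i = 0) →
      ∀ v ∈ coneCompl (U m), 1 ≤ ‖zcast (Finsupp.linearCombination ℤ c e) - v‖ :=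
    fun e he he0 m hm v hv =>
      one_le_norm_zcast_linearCombination_sub (S := fun n => coneCompl (U n))
        (fun m n hmn => coneCompl_anti (hUanti hmn)) (fun n v hv t => smul_mem_coneCompl hv t)
        hcfar he he0 hm hv
  obtain ⟨X, mX, hX, μ, hμ, hμX, T, hT, hfree, hrec, hnrec⟩ := exists_action_of_signed_sums c
    fun e he he0 h0 => by
      have := hsum e he he0 0 (by simp) 0 fun h => absurd rfl h
      have hz : zcast (0 : Fin d → ℤ) = 0 := funext fun j => Int.cast_zero
      norm_num [h0, hz] at this
  refine ⟨X, mX, hX, μ, hμ, hμX, T, hT, hfree, ?_, fun θ hθ => ?_⟩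
  · rintro _ ⟨a, rfl⟩
    refine hrec _ fun ε hε =>
      Nat.frequently_atTop_iff_infinite.1 (frequently_atTop.2 fun N => ?_)
    obtain ⟨K, hK⟩ := exists_nat_one_div_lt hε
    refine ⟨Nat.pair a (max N K), (le_max_left _ _).trans (Nat.right_le_pair _ _), ?_⟩
    obtain ⟨w, hw, hlt⟩ := hcθ (Nat.pair a (max N K))
    rw [Nat.unpair_pair] at hw
    refine ⟨w, hw, hlt.trans (lt_of_le_of_lt ?_ hK)⟩
    have : K ≤ Nat.pair a (max N K) := (le_max_right _ _).trans (Nat.right_le_pair _ _)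
    gcongr
  · by_contra hθO
    obtain ⟨m, hm⟩ : ∃ m, θ ∉ O m := by simpa using hθO
    have hmU : θ ∉ U m := fun h => hm (mem_iInter₂.1 h m self_mem_Iic)
    exact hnrec θ (Finset.range m) (fun e he he0 hK v hv =>
      hsum e he he0 m (fun i hi => hK i (Finset.mem_range.2 hi)) v
        (mem_coneCompl_of_mem_submodule hmU hv)) hθ
end
end

section
/- Let d ≥ 1 and let D be a countable G_δ-subset of the projective space P(ℝ^d) (for instance, any countable compact subset). Then there exists a free measure preserving ℤ^d-action T on a σ-finite standard measure space (X, μ) with μ(X) = ∞ such that 𝓡(T) = D. -/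
open MeasureTheory Filter Set Topology

noncomputable section

/-- A disjoint union of countably many standard Borel spaces is standard Borel. -/
theorem standardBorelSpace_sigma {ι : Type*} [Countable ι] {X : ι → Type*}
    [∀ i, MeasurableSpace (X i)] [∀ i, StandardBorelSpace (X i)] :
    StandardBorelSpace (Σ i, X i) := by
  choose τ hB hP using fun i => StandardBorelSpace.polish (α := X i)
  have hb : BorelSpace (Σ i, X i) := by
    refine ⟨le_antisymm ?_ (MeasurableSpace.generateFrom_le fun s hs => ?_)⟩
    · intro s hs
      have hs' : ∀ i, MeasurableSet (Sigma.mk i ⁻¹' s) := fun i =>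
        MeasurableSpace.measurableSet_iInf.1 hs i
      have : s = ⋃ i, Sigma.mk i '' (Sigma.mk i ⁻¹' s) := by
        ext ⟨i, x⟩
        simp only [mem_iUnion, mem_image, mem_preimage]
        exact ⟨fun h => ⟨i, x, h, rfl⟩, fun ⟨j, y, h, e⟩ => e ▸ h⟩
      rw [this]
      let _ : MeasurableSpace (Σ i, X i) := borel _
      have : BorelSpace (Σ i, X i) := ⟨rfl⟩
      exact MeasurableSet.iUnion fun i =>
        IsOpenEmbedding.sigmaMk.measurableEmbedding.measurableSet_image.2 (hs' i)
    · exact MeasurableSpace.measurableSet_iInf.2 fun i =>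
        (isOpen_sigma_iff.1 hs i).measurableSet
  exact ⟨inferInstance, hb, inferInstance⟩

/-- The supremum of the translates of a measure `P` under a countable group of transformations. -/
def supMeasure {G X : Type*} [MeasurableSpace X] (P : Measure X) (T : G → X ≃ᵐ X) : Measure X :=
  ⨆ γ, P.map (T γ)

section supMeasure

variable {G X : Type*} [MeasurableSpace X] {P : Measure X}
  {T : G → X ≃ᵐ X} {E : Set X}

theorem supMeasure_restrict_le [Countable G] (hE : MeasurableSet E)
    (h : ∀ γ, (P.map (T γ)).restrict E ≤ P) : (supMeasure P T).restrict E ≤ P := by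
  have h1 : supMeasure P T ≤ P + (Measure.sum fun γ => P.map (T γ)).restrict Eᶜ := by
    refine iSup_le fun γ => ?_
    rw [← Measure.restrict_add_restrict_compl (μ := P.map (T γ)) hE]
    exact add_le_add (h γ) (Measure.restrict_mono le_rfl (Measure.le_sum _ γ))
  calc (supMeasure P T).restrict E
      ≤ (P + (Measure.sum fun γ => P.map (T γ)).restrict Eᶜ).restrict E :=
        Measure.restrict_mono le_rfl h1
    _ = P.restrict E := by
        rw [Measure.restrict_add, Measure.restrict_restrict hE, inter_compl_self]
        simp
    _ ≤ P := Measure.restrict_le_self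

theorem supMeasure_apply_le [Countable G] (hE : MeasurableSet E)
    (h : ∀ γ, (P.map (T γ)).restrict E ≤ P) {A : Set X} (hA : A ⊆ E) :
    supMeasure P T A ≤ P A := by
  rw [← Measure.restrict_eq_self (supMeasure P T) hA]
  exact supMeasure_restrict_le hE h A

/-- The translates of a full-measure set `E` exhaust `supMeasure P T`. -/
theorem supMeasure_compl_iUnion_image [Countable G] (hPE : P Eᶜ = 0) :
    supMeasure P T (⋃ γ, T γ '' E)ᶜ = 0 := by
  refine le_antisymm ?_ zero_le
  have h1 : supMeasure P T ≤ Measure.sum fun γ => P.map (T γ) :=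
    iSup_le fun γ => Measure.le_sum (fun γ => P.map (T γ)) γ
  refine (h1 _).trans (le_of_eq ?_)
  rw [Measure.sum_apply_of_countable, ENNReal.tsum_eq_zero]
  intro γ
  rw [(T γ).map_apply]
  refine measure_mono_null ?_ hPE
  intro x hx hxE
  exact hx (mem_iUnion.2 ⟨γ, mem_image_of_mem _ hxE⟩)

variable [AddCommGroup G]

theorem action_zero (hT : ∀ γ γ' x, T (γ + γ') x = T γ (T γ' x)) (x : X) : T 0 x = x :=
  (T 0).injective (by rw [← hT, add_zero])

theorem map_supMeasure_le (hT : ∀ γ γ' x, T (γ + γ') x = T γ (T γ' x)) (γ : G) :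
    (supMeasure P T).map (T γ) ≤ supMeasure P T := by
  have h : supMeasure P T ≤ (supMeasure P T).map (T γ).symm := by
    refine iSup_le fun δ => ?_
    have h1 : P.map (T δ) = (P.map (T (γ + δ))).map (T γ).symm := by
      rw [Measure.map_map (T γ).symm.measurable (T (γ + δ)).measurable]
      congr 1
      ext x
      simp [hT]
    rw [h1]
    exact Measure.map_mono (le_iSup (fun γ => P.map (T γ)) _) (T γ).symm.measurable
  have h2 := Measure.map_mono h (T γ).measurable
  rwa [Measure.map_map (T γ).measurable (T γ).symm.measurable, MeasurableEquiv.self_comp_symm,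
    Measure.map_id] at h2

theorem measurePreserving_supMeasure (hT : ∀ γ γ' x, T (γ + γ') x = T γ (T γ' x)) (γ : G) :
    MeasurePreserving (T γ) (supMeasure P T) (supMeasure P T) := by
  refine ⟨(T γ).measurable, le_antisymm (map_supMeasure_le hT γ) ?_⟩
  have h := Measure.map_mono (map_supMeasure_le (P := P) hT (-γ)) (T γ).measurable
  rw [Measure.map_map (T γ).measurable (T (-γ)).measurable] at h
  have : T γ ∘ T (-γ) = id := by
    ext x
    simp [← hT, action_zero hT]
  rwa [this, Measure.map_id] at h

theorem le_supMeasure (hT : ∀ γ γ' x, T (γ + γ') x = T γ (T γ' x)) : P ≤ supMeasure P T :=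
  calc P = P.map (T 0) := by
        rw [show (T 0 : X → X) = id from funext (action_zero hT), Measure.map_id]
    _ ≤ supMeasure P T := le_iSup (fun γ => P.map (T γ)) 0

theorem supMeasure_image (hT : ∀ γ γ' x, T (γ + γ') x = T γ (T γ' x)) (γ : G) (A : Set X) :
    supMeasure P T (T γ '' A) = supMeasure P T A := by
  conv_rhs => rw [← (T γ).injective.preimage_image A]
  exact ((measurePreserving_supMeasure hT γ).measure_preimage_equiv _).symm

theorem sigmaFinite_supMeasure [Countable G] [IsFiniteMeasure P]
    (hT : ∀ γ γ' x, T (γ + γ') x = T γ (T γ' x)) (hE : MeasurableSet E) (hPE : P Eᶜ = 0)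
    (h : ∀ γ, (P.map (T γ)).restrict E ≤ P) : SigmaFinite (supMeasure P T) := by
  refine Measure.sigmaFinite_of_countable
    (S := insert (⋃ γ, T γ '' E)ᶜ (range fun γ => T γ '' E))
    ((countable_range _).insert _) ?_ ?_
  · rintro s (rfl | ⟨γ, rfl⟩)
    · rw [supMeasure_compl_iUnion_image hPE]
      exact ENNReal.zero_lt_top
    · simp only [supMeasure_image hT]
      exact (supMeasure_apply_le hE h subset_rfl).trans_lt (measure_lt_top _ _)
  · rw [sUnion_insert, sUnion_range, compl_union_self]

end supMeasure

/-- The action on a disjoint union acting on each summand. -/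
def sigmaAction {Γ ι : Type*} {X : ι → Type*} [∀ i, MeasurableSpace (X i)]
    (T : ∀ i, Γ → X i ≃ᵐ X i) (γ : Γ) : (Σ i, X i) ≃ᵐ (Σ i, X i) where
  toEquiv := Equiv.sigmaCongrRight fun i => (T i γ).toEquiv
  measurable_toFun := by
    intro s hs
    refine MeasurableSpace.measurableSet_iInf.2 fun i => ?_
    exact (T i γ).measurable (MeasurableSpace.measurableSet_iInf.1 hs i)
  measurable_invFun := by
    intro s hs
    refine MeasurableSpace.measurableSet_iInf.2 fun i => ?_
    exact (T i γ).symm.measurable (MeasurableSpace.measurableSet_iInf.1 hs i)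

/-- The measure on a disjoint union restricting to the given measure on each summand. -/
def sigmaMeasure {ι : Type*} {X : ι → Type*} [∀ i, MeasurableSpace (X i)]
    (μ : ∀ i, Measure (X i)) : Measure (Σ i, X i) :=
  Measure.sum fun i => (μ i).map (Sigma.mk i)

section sigma

variable {ι : Type*} {X : ι → Type*} [∀ i, MeasurableSpace (X i)] {μ : ∀ i, Measure (X i)}

theorem measurableEmbedding_sigmaMk (i : ι) :
    MeasurableEmbedding (Sigma.mk i : X i → Σ i, X i) where
  injective := sigma_mk_injective
  measurable := fun _ hs => MeasurableSpace.measurableSet_iInf.1 hs i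
  measurableSet_image' := by
    intro s hs
    refine MeasurableSpace.measurableSet_iInf.2 fun j => ?_
    change MeasurableSet (Sigma.mk j ⁻¹' _)
    by_cases h : i = j
    · subst h
      rwa [sigma_mk_injective.preimage_image]
    · rw [preimage_image_sigmaMk_of_ne (Ne.symm h)]
      exact .empty

theorem sigmaMeasure_apply [Countable ι] (s : Set (Σ i, X i)) :
    sigmaMeasure μ s = ∑' i, μ i (Sigma.mk i ⁻¹' s) := by
  rw [sigmaMeasure, Measure.sum_apply_of_countable]
  simp_rw [(measurableEmbedding_sigmaMk _).map_apply]

theorem sigmaMeasure_image_mk [Countable ι] (i : ι) (s : Set (X i)) :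
    sigmaMeasure μ (Sigma.mk i '' s) = μ i s := by
  rw [sigmaMeasure_apply, tsum_eq_single i, sigma_mk_injective.preimage_image]
  intro j hj
  rw [preimage_image_sigmaMk_of_ne hj, measure_empty]

theorem sigmaFinite_sigmaMeasure [Countable ι] [∀ i, SigmaFinite (μ i)] :
    SigmaFinite (sigmaMeasure μ) := by
  refine Measure.sigmaFinite_of_countable
    (S := range fun p : ι × ℕ => Sigma.mk p.1 '' spanningSets (μ p.1) p.2)
    (countable_range _) ?_ ?_
  · rintro s ⟨p, rfl⟩
    simp only [sigmaMeasure_image_mk]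
    exact measure_spanningSets_lt_top _ _
  · refine eq_univ_of_forall fun ⟨i, x⟩ => ?_
    obtain ⟨n, hn⟩ := mem_iUnion.1 ((iUnion_spanningSets (μ i)).symm ▸ mem_univ x)
    exact ⟨_, ⟨(i, n), rfl⟩, mem_image_of_mem _ hn⟩

theorem isMPAction_sigmaAction [Countable ι] {d : ℕ} {T : ∀ i, (Fin d → ℤ) → X i ≃ᵐ X i}
    (h : ∀ i, IsMPAction (μ i) (T i)) : IsMPAction (sigmaMeasure μ) (sigmaAction T) := by
  refine ⟨fun γ γ' ⟨i, x⟩ => ?_, fun γ => ⟨(sigmaAction T γ).measurable, ?_⟩⟩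
  · exact congrArg (Sigma.mk i) ((h i).1 γ γ' x)
  · ext s hs
    rw [Measure.map_apply (sigmaAction T γ).measurable hs, sigmaMeasure_apply, sigmaMeasure_apply]
    exact tsum_congr fun i => ((h i).2 γ).measure_preimage_equiv (Sigma.mk i ⁻¹' s)

theorem isFreeAction_sigmaAction [Countable ι] {d : ℕ} {T : ∀ i, (Fin d → ℤ) → X i ≃ᵐ X i}
    (h : ∀ i, IsFreeAction (μ i) (T i)) : IsFreeAction (sigmaMeasure μ) (sigmaAction T) := by
  intro γ hγ
  rw [ae_iff, sigmaMeasure_apply, ENNReal.tsum_eq_zero]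
  intro i
  refine measure_mono_null (fun x hx => ?_) (ae_iff.1 (h i γ hγ))
  simp only [not_not, mem_ofPred_eq, mem_preimage] at hx ⊢
  exact sigma_mk_injective hx

theorem recSet_sigmaAction [Countable ι] {d : ℕ} {T : ∀ i, (Fin d → ℤ) → X i ≃ᵐ X i} :
    recSet (sigmaMeasure μ) (sigmaAction T) = ⋂ i, recSet (μ i) (T i) := by
  have himg : ∀ (i : ι) (γ : Fin d → ℤ) (s : Set (Σ i, X i)),
      Sigma.mk i ⁻¹' (sigmaAction T γ '' s) = T i γ '' (Sigma.mk i ⁻¹' s) := by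
    intro i γ s
    ext x
    constructor
    · rintro ⟨⟨j, y⟩, hy, e⟩
      obtain rfl : j = i := congrArg Sigma.fst e
      exact ⟨y, hy, sigma_mk_injective e⟩
    · rintro ⟨y, hy, rfl⟩
      exact ⟨⟨i, y⟩, hy, rfl⟩
  ext θ
  simp only [mem_iInter]
  constructor
  · intro h i ε hε A hA hpos
    obtain ⟨γ, hγ, v, hv, hd, hp⟩ := h ε hε (Sigma.mk i '' A)
      ((measurableEmbedding_sigmaMk i).measurableSet_image.2 hA)
      (by rwa [sigmaMeasure_image_mk])
    refine ⟨γ, hγ, v, hv, hd, ?_⟩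
    rw [← sigmaMeasure_image_mk (μ := μ) i]
    refine hp.trans_le (measure_mono ?_)
    rintro _ ⟨⟨x, hx, rfl⟩, hx'⟩
    refine ⟨x, ⟨hx, ?_⟩, rfl⟩
    have : x ∈ Sigma.mk i ⁻¹' (sigmaAction T γ '' (Sigma.mk i '' A)) := hx'
    rwa [himg, sigma_mk_injective.preimage_image] at this
  · intro h ε hε A hA hpos
    obtain ⟨i, hi⟩ : ∃ i, μ i (Sigma.mk i ⁻¹' A) ≠ 0 := by
      by_contra! hc
      rw [sigmaMeasure_apply, ENNReal.tsum_eq_zero.2 hc] at hpos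
      exact hpos.ne rfl
    obtain ⟨γ, hγ, v, hv, hd, hp⟩ := h i ε hε _
      ((measurableEmbedding_sigmaMk i).measurable hA) (pos_iff_ne_zero.2 hi)
    refine ⟨γ, hγ, v, hv, hd, ?_⟩
    rw [← himg, ← preimage_inter] at hp
    rw [sigmaMeasure_apply]
    exact hp.trans_le (ENNReal.le_tsum (f := fun i => μ i (Sigma.mk i ⁻¹' _)) i)

end sigma

section Odometer

variable {G : ℕ → Type} [∀ n, MeasurableSpace (G n)] [∀ n, DiscreteMeasurableSpace (G n)]

/-- The product of the uniform measures on the sets `I n`. -/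
def piUniform (I : ∀ n, Set (G n)) : Measure (∀ n, G n) :=
  Measure.infinitePi fun n => ProbabilityTheory.uniformOn (I n)

theorem measurableSet_univ_pi (I : ∀ n, Set (G n)) : MeasurableSet (univ.pi I) :=
  MeasurableSet.univ_pi fun _ => .of_discrete

variable {I : ∀ n, Set (G n)} (hI : ∀ n, (I n).Finite) (hI' : ∀ n, (I n).Nonempty)

include hI hI'

theorem isProbabilityMeasure_piUniform : IsProbabilityMeasure (piUniform I) := by
  have h n := ProbabilityTheory.isProbabilityMeasure_uniformOn (hI n) (hI' n)
  unfold piUniform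
  infer_instance

theorem piUniform_compl : piUniform I (univ.pi I)ᶜ = 0 := by
  have h n := ProbabilityTheory.isProbabilityMeasure_uniformOn (hI n) (hI' n)
  have := isProbabilityMeasure_piUniform hI hI'
  rw [prob_compl_eq_zero_iff (measurableSet_univ_pi I), piUniform,
    Measure.infinitePi_pi_univ _ fun _ => .of_discrete]
  simp [ProbabilityTheory.uniformOn_self (hI _) (hI' _)]

theorem piUniform_pi_compl_le (J : ∀ n, Set (G n)) :
    piUniform I (univ.pi J)ᶜ ≤ ∑' n, ProbabilityTheory.uniformOn (I n) (J n)ᶜ := by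
  have h n := ProbabilityTheory.isProbabilityMeasure_uniformOn (hI n) (hI' n)
  have : (univ.pi J)ᶜ ⊆ ⋃ n, (fun x : ∀ n, G n => x n) ⁻¹' (J n)ᶜ := by
    intro x hx
    by_contra hc
    simp only [mem_iUnion, mem_preimage, mem_compl_iff, not_exists, not_not] at hc
    exact hx fun n _ => hc n
  refine (measure_mono this).trans ((measure_iUnion_le _).trans (ENNReal.tsum_le_tsum fun n => ?_))
  rw [← Measure.map_apply (measurable_pi_apply n) .of_discrete, piUniform,
    Measure.infinitePi_map_eval]

omit hI hI'

variable [∀ n, AddCommGroup (G n)]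

/-- Translation by `a` on a product of discrete groups. -/
def piTranslation (a : ∀ n, G n) : (∀ n, G n) ≃ᵐ (∀ n, G n) where
  toEquiv := Equiv.addLeft a
  measurable_toFun := measurable_pi_lambda _ fun n =>
    (Measurable.of_discrete (f := fun y : G n => a n + y)).comp (measurable_pi_apply n)
  measurable_invFun := measurable_pi_lambda _ fun n =>
    (Measurable.of_discrete (f := fun y : G n => -a n + y)).comp (measurable_pi_apply n)

@[simp]
theorem piTranslation_apply (a x : ∀ n, G n) : piTranslation a x = a + x := rfl

theorem piTranslation_image_pi (a : ∀ n, G n) (I : ∀ n, Set (G n)) :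
    piTranslation a '' univ.pi I = univ.pi fun n => (fun y => a n + y) '' I n := by
  ext x
  constructor
  · rintro ⟨y, hy, rfl⟩ n -
    exact ⟨y n, hy n trivial, rfl⟩
  · intro hx
    choose y hy hyx using fun n => hx n trivial
    exact ⟨y, fun n _ => hy n, funext hyx⟩

theorem uniformOn_map_add_inter {H : Type*} [AddCommGroup H] [MeasurableSpace H]
    [DiscreteMeasurableSpace H] (I t : Set H) (a : H) :
    (ProbabilityTheory.uniformOn I).map (fun y => a + y) (t ∩ I)
      = ProbabilityTheory.uniformOn I (t ∩ (fun y => a + y) '' I) := by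
  rw [Measure.map_apply .of_discrete .of_discrete, ProbabilityTheory.uniformOn,
    ProbabilityTheory.cond_apply .of_discrete, ProbabilityTheory.cond_apply .of_discrete]
  congr 1
  rw [← Measure.count_injective_image (add_right_injective a)]
  congr 1
  ext x
  constructor
  · rintro ⟨y, ⟨hy, hyt, hyI⟩, rfl⟩
    exact ⟨hyI, hyt, y, hy, rfl⟩
  · rintro ⟨hxI, hxt, y, hy, rfl⟩
    exact ⟨y, ⟨hy, hxt, hxI⟩, rfl⟩

include hI hI'

theorem piUniform_map_restrict (a : ∀ n, G n) :
    ((piUniform I).map (piTranslation a)).restrict (univ.pi I)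
      = (piUniform I).restrict (piTranslation a '' univ.pi I) := by
  have h n := ProbabilityTheory.isProbabilityMeasure_uniformOn (hI n) (hI' n)
  have := isProbabilityMeasure_piUniform hI hI'
  have h' n : IsProbabilityMeasure
      ((ProbabilityTheory.uniformOn (I n)).map fun y => a n + y) :=
    Measure.isProbabilityMeasure_map (Measurable.of_discrete).aemeasurable
  have hmap : (piUniform I).map (piTranslation a)
      = Measure.infinitePi fun n => (ProbabilityTheory.uniformOn (I n)).map fun y => a n + y :=
    Measure.infinitePi_map_pi (μ := fun n => ProbabilityTheory.uniformOn (I n))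
      (f := fun n y => a n + y) fun n => .of_discrete
  have hbox : ∀ t : ∀ n, Set (G n),
      ((piUniform I).map (piTranslation a)).restrict (univ.pi I) (univ.pi t)
        = (piUniform I).restrict (piTranslation a '' univ.pi I) (univ.pi t) := by
    intro t
    rw [Measure.restrict_apply (measurableSet_univ_pi t),
      Measure.restrict_apply (measurableSet_univ_pi t), piTranslation_image_pi,
      ← pi_inter_distrib, ← pi_inter_distrib, hmap, piUniform,
      Measure.infinitePi_pi_univ _ fun _ => .of_discrete,
      Measure.infinitePi_pi_univ _ fun _ => .of_discrete]
    exact tprod_congr fun n => uniformOn_map_add_inter _ _ _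
  refine ext_of_generate_finite _ generateFrom_squareCylinders.symm
    (isPiSystem_squareCylinders (fun _ => MeasurableSpace.isPiSystem_measurableSet)
      fun _ => MeasurableSet.univ) ?_ ?_
  · classical
    rintro _ ⟨s, t, -, rfl⟩
    rw [← univ_pi_piecewise_univ (s : Set ℕ) t]
    exact hbox _
  · simpa using hbox fun _ => univ

variable {d : ℕ} (π : ∀ n, (Fin d → ℤ) →+ G n)

omit hI hI' in
theorem piTranslation_action (γ γ' : Fin d → ℤ) (x : ∀ n, G n) :
    piTranslation (fun n => π n (γ + γ')) x
      = piTranslation (fun n => π n γ) (piTranslation (fun n => π n γ') x) := by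
  ext n
  simp [add_assoc]

theorem piUniform_map_restrict_le (γ : Fin d → ℤ) :
    ((piUniform I).map (piTranslation fun n => π n γ)).restrict (univ.pi I) ≤ piUniform I :=
  (piUniform_map_restrict hI hI' _).le.trans Measure.restrict_le_self

/-- The `ℤ^d`-invariant measure on the product of the groups `G n`, obtained from the product of
the uniform measures on the sets `I n`. -/
def odometerMeasure {d : ℕ} (I : ∀ n, Set (G n)) (π : ∀ n, (Fin d → ℤ) →+ G n) :
    Measure (∀ n, G n) :=
  supMeasure (piUniform I) fun γ => piTranslation fun n => π n γ

theorem odometerMeasure_eq {A : Set (∀ n, G n)} (hA : A ⊆ univ.pi I) :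
    odometerMeasure I π A = piUniform I A :=
  le_antisymm (supMeasure_apply_le (measurableSet_univ_pi I)
    (piUniform_map_restrict_le hI hI' π) hA)
    (le_supMeasure (piTranslation_action π) A)

theorem measure_inter_translate_pos {A : Set (∀ n, G n)} (hA : MeasurableSet A)
    (hAE : A ⊆ univ.pi I) (hpos : 0 < piUniform I A) :
    ∃ N : ℕ, ∃ η : ENNReal, 0 < η ∧ ∀ γ : Fin d → ℤ, (∀ n < N, π n γ = 0) →
      piUniform I (piTranslation (fun n => π n γ) '' univ.pi I)ᶜ < η →
      0 < odometerMeasure I π (A ∩ piTranslation (fun n => π n γ) '' A) := by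
  have := isProbabilityMeasure_piUniform hI hI'
  set P := piUniform I
  set μ := odometerMeasure I π
  obtain ⟨C, hC, hAC⟩ := (Measure.MeasureDense.of_generateFrom_isSetAlgebra_finite P
    isSetAlgebra_measurableCylinders
    generateFrom_measurableCylinders.symm).approx A hA (measure_ne_top _ _) ((P A).toReal / 4)
    (by have := ENNReal.toReal_pos hpos.ne' (measure_ne_top _ _); positivity)
  obtain ⟨s, S, hS, rfl⟩ := (mem_measurableCylinders C).1 hC
  set C := cylinder s S
  have h4 : ENNReal.ofReal ((P A).toReal / 4) = P A / 4 := by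
    rw [ENNReal.ofReal_div_of_pos (by norm_num), ENNReal.ofReal_toReal (measure_ne_top _ _)]
    simp
  rw [h4] at hAC
  refine ⟨s.sup id + 1, P A / 4, by simp [hpos.ne'], fun γ hγ hη => ?_⟩
  set T : (∀ n, G n) ≃ᵐ (∀ n, G n) := piTranslation fun n => π n γ
  have hTC : ∀ x, x ∈ C ↔ T x ∈ C := by
    intro x
    simp only [C, mem_cylinder]
    have : (s.restrict (T x)) = s.restrict x := by
      ext n
      simp [T, hγ n (Nat.lt_succ_of_le (Finset.le_sup (f := id) n.2))]
    rw [this]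
  have hTμ : ∀ B, μ (T '' B) = μ B :=
    supMeasure_image (T := fun γ => piTranslation fun n => π n γ) (piTranslation_action π) γ
  have hsub : A ⊆ (A ∩ T '' A) ∪ ((A \ C) ∪ ((univ.pi I \ T '' univ.pi I) ∪
      T '' ((univ.pi I ∩ C) \ A))) := by
    intro x hx
    by_cases hxC : x ∈ C
    · by_cases hxE : x ∈ T '' univ.pi I
      · obtain ⟨y, hy, rfl⟩ := hxE
        by_cases hyA : y ∈ A
        · exact Or.inl ⟨hx, y, hyA, rfl⟩
        · exact Or.inr (Or.inr (Or.inr ⟨y, ⟨⟨hy, (hTC y).2 hxC⟩, hyA⟩, rfl⟩))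
      · exact Or.inr (Or.inr (Or.inl ⟨hAE hx, hxE⟩))
    · exact Or.inr (Or.inl ⟨hx, hxC⟩)
  have e : ∀ {B}, B ⊆ univ.pi I → μ B = P B := fun hB => odometerMeasure_eq hI hI' π hB
  by_contra h0
  have h0' : μ (A ∩ T '' A) = 0 := by simpa using h0
  have hle : P A ≤ P A / 4 + (P A / 4 + P A / 4) := by
    calc P A = μ A := (e hAE).symm
      _ ≤ μ (A ∩ T '' A) + (μ (A \ C) + (μ (univ.pi I \ T '' univ.pi I) +
          μ (T '' ((univ.pi I ∩ C) \ A)))) :=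
        (measure_mono hsub).trans ((measure_union_le _ _).trans (add_le_add_right
          ((measure_union_le _ _).trans (add_le_add_right (measure_union_le _ _) _)) _))
      _ = P (A \ C) + (P (univ.pi I \ T '' univ.pi I) + P ((univ.pi I ∩ C) \ A)) := by
        rw [h0', zero_add, hTμ, e (sdiff_subset.trans hAE), e sdiff_subset,
          e (sdiff_subset.trans inter_subset_left)]
      _ ≤ _ := by
        gcongr
        · exact (measure_mono subset_union_left).trans hAC.le
        · exact (measure_mono fun x hx => hx.2).trans hη.le
        · exact (measure_mono fun x hx => Or.inr ⟨hx.1.2, hx.2⟩).trans hAC.le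
  have hfin := measure_ne_top P A
  have hp := ENNReal.toReal_pos hpos.ne' hfin
  have := ENNReal.toReal_mono (by simp [ENNReal.div_eq_top, hfin]) hle
  have h4t : P A / 4 ≠ ⊤ := by simp [ENNReal.div_eq_top, hfin]
  rw [ENNReal.toReal_add h4t (by simp [h4t]), ENNReal.toReal_add h4t h4t,
    ENNReal.toReal_div] at this
  simp at this
  linarith

theorem recurrentAlong_odometer (θ : Projectivization ℝ (Fin d → ℝ))
    (h : ∀ ε : ℝ, 0 < ε → ∀ N : ℕ, ∀ η : ENNReal, 0 < η → ∃ γ : Fin d → ℤ, γ ≠ 0 ∧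
      (∃ v ∈ θ.submodule, ‖zcast γ - v‖ < ε) ∧ (∀ n < N, π n γ = 0) ∧
      piUniform I (piTranslation (fun n => π n γ) '' univ.pi I)ᶜ < η) :
    RecurrentAlong (odometerMeasure I π) (fun γ => piTranslation fun n => π n γ) θ := by
  intro ε hε A hA hpos
  set T : (Fin d → ℤ) → (∀ n, G n) ≃ᵐ (∀ n, G n) := fun γ => piTranslation fun n => π n γ
  have hT : ∀ γ γ' x, T (γ + γ') x = T γ (T γ' x) := piTranslation_action π
  have hTμ : ∀ γ B, odometerMeasure I π (T γ '' B) = odometerMeasure I π B :=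
    supMeasure_image hT
  obtain ⟨δ, hδ⟩ : ∃ δ, odometerMeasure I π (A ∩ T δ '' univ.pi I) ≠ 0 := by
    by_contra! hc
    refine hpos.ne' (measure_mono_null (t := (⋃ γ, T γ '' univ.pi I)ᶜ ∪
      ⋃ γ, (A ∩ T γ '' univ.pi I)) ?_ (measure_union_null
        (supMeasure_compl_iUnion_image (piUniform_compl hI hI')) (measure_iUnion_null hc)))
    intro x hx
    by_cases hx' : x ∈ ⋃ γ, T γ '' univ.pi I
    · rw [← inter_iUnion]
      exact Or.inr ⟨hx, hx'⟩
    · exact Or.inl hx'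
  set B := T δ ⁻¹' A ∩ univ.pi I
  have hBim : T δ '' B = A ∩ T δ '' univ.pi I := by
    rw [image_preimage_inter]
  have hBE : B ⊆ univ.pi I := inter_subset_right
  obtain ⟨N, η, hη, hN⟩ := measure_inter_translate_pos hI hI' π
    (((T δ).measurable hA).inter (measurableSet_univ_pi I)) hBE
    (by rw [← odometerMeasure_eq hI hI' π hBE, ← hTμ δ, hBim]; exact pos_iff_ne_zero.2 hδ)
  obtain ⟨γ, hγ, ⟨v, hv, hd⟩, hγN, hγη⟩ := h ε hε N η hη
  refine ⟨γ, hγ, v, hv, hd, ?_⟩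
  have := hN γ hγN hγη
  rw [← hTμ δ] at this
  refine this.trans_le (measure_mono ?_)
  rintro _ ⟨x, ⟨hx, y, hy, rfl⟩, rfl⟩
  refine ⟨hx.1, T δ y, hy.1, ?_⟩
  change T γ (T δ y) = T δ (T γ y)
  rw [← hT, ← hT, add_comm]

theorem not_recurrentAlong_odometer (θ : Projectivization ℝ (Fin d → ℝ))
    (h : ∀ γ : Fin d → ℤ, γ ≠ 0 → (∃ v ∈ θ.submodule, ‖zcast γ - v‖ < 1) →
      ∃ n, ∀ x ∈ I n, ∀ y ∈ I n, x ≠ π n γ + y) :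
    ¬ RecurrentAlong (odometerMeasure I π) (fun γ => piTranslation fun n => π n γ) θ := by
  intro hr
  have := isProbabilityMeasure_piUniform hI hI'
  have hP : piUniform I (univ.pi I) = 1 :=
    (prob_compl_eq_zero_iff (measurableSet_univ_pi I)).1 (piUniform_compl hI hI')
  obtain ⟨γ, hγ, v, hv, hd, hp⟩ := hr 1 one_pos (univ.pi I) (measurableSet_univ_pi I)
    (by rw [odometerMeasure_eq hI hI' π subset_rfl, hP]; exact one_pos)
  obtain ⟨n, hn⟩ := h γ hγ ⟨v, hv, hd⟩
  refine hp.ne' (measure_mono_null ?_ measure_empty)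
  rintro _ ⟨hx, y, hy, rfl⟩
  exact hn _ (hx n trivial) _ (hy n trivial) rfl

end Odometer

section Lattice

variable {d : ℕ}

theorem exists_int_near_line (p : Fin d → ℝ) {ε : ℝ} (hε : 0 < ε) {M : ℤ} (hM : 0 < M) (R : ℝ) :
    ∃ (γ : Fin d → ℤ) (t : ℝ), ‖zcast γ - t • p‖ < ε ∧ R ≤ |t| ∧ ∀ i, M ∣ γ i := by
  have hM' : (0 : ℝ) < M := by exact_mod_cast hM
  set S : ℝ := max R 1
  have hS : 0 < S := lt_max_of_lt_right one_pos
  let y : ℕ → Fin d → ℝ := fun j i => Int.fract (j * (S * p i / M))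
  have hy : ∀ j, y j ∈ Icc (0 : Fin d → ℝ) 1 := fun j =>
    ⟨fun i => Int.fract_nonneg _, fun i => (Int.fract_lt_one _).le⟩
  obtain ⟨_, -, φ, hφ, hlim⟩ := isCompact_Icc.tendsto_subseq hy
  obtain ⟨N, hN⟩ := Metric.cauchySeq_iff.1 hlim.cauchySeq (ε / M) (by positivity)
  have hlt := hφ (Nat.lt_succ_self N)
  have hd := hN (N + 1) (Nat.le_succ N) N le_rfl
  set a := φ N
  set b := φ (N + 1)
  have hab : (1 : ℝ) ≤ (b : ℝ) - a := by
    have : (a : ℝ) + 1 ≤ b := by exact_mod_cast hlt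
    linarith
  refine ⟨fun i => M * (⌊(b : ℝ) * (S * p i / M)⌋ - ⌊(a : ℝ) * (S * p i / M)⌋), (b - a) * S,
    ?_, ?_, fun i => dvd_mul_right _ _⟩
  · rw [dist_eq_norm, lt_div_iff₀ hM', mul_comm] at hd
    have hn : (M : ℝ) * ‖(y ∘ φ) (N + 1) - (y ∘ φ) N‖
        = ‖-((M : ℝ) • ((y ∘ φ) (N + 1) - (y ∘ φ) N))‖ := by
      rw [norm_neg, norm_smul, Real.norm_of_nonneg hM'.le]
    rw [hn] at hd
    refine lt_of_eq_of_lt (congrArg _ (funext fun i => ?_)) hd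
    change (((M * (⌊(b : ℝ) * (S * p i / M)⌋ - ⌊(a : ℝ) * (S * p i / M)⌋) : ℤ)) : ℝ)
      - (b - a) * S * p i
        = -(M * (Int.fract (b * (S * p i / M)) - Int.fract (a * (S * p i / M))))
    simp only [Int.fract]
    push_cast
    field_simp
    ring
  · rw [abs_of_pos (by positivity)]
    have : R ≤ S := le_max_left _ _
    nlinarith

/-- The subgroup of `ℤ^d` generated by `γ` and the multiples of `Q` in the coordinates other
than `i₀`. -/
def lineLattice (γ : Fin d → ℤ) (i₀ : Fin d) (Q : ℤ) : AddSubgroup (Fin d → ℤ) where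
  carrier := {x | ∃ k : ℤ, x i₀ = k * γ i₀ ∧ ∀ i, Q ∣ x i - k * γ i}
  zero_mem' := ⟨0, by simp⟩
  add_mem' := by
    rintro x y ⟨k, hk, hx⟩ ⟨l, hl, hy⟩
    refine ⟨k + l, by rw [Pi.add_apply, hk, hl]; ring, fun i => ?_⟩
    have h := dvd_add (hx i) (hy i)
    rw [Pi.add_apply]
    rwa [show x i + y i - (k + l) * γ i = x i - k * γ i + (y i - l * γ i) by ring]
  neg_mem' := by
    rintro x ⟨k, hk, hx⟩
    refine ⟨-k, by rw [Pi.neg_apply, hk]; ring, fun i => ?_⟩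
    rw [Pi.neg_apply, show -x i - -k * γ i = -(x i - k * γ i) by ring]
    exact (hx i).neg_right

theorem mem_lineLattice_of_dvd {γ : Fin d → ℤ} {i₀ : Fin d} {Q : ℤ} {x : Fin d → ℤ}
    (h : ∀ i, |γ i₀| * Q ∣ x i) : x ∈ lineLattice γ i₀ Q := by
  obtain ⟨c, hc⟩ : γ i₀ * Q ∣ x i₀ := by
    rw [← abs_dvd, abs_mul]
    exact (mul_dvd_mul_left _ (abs_dvd_self Q)).trans (h i₀)
  refine ⟨c * Q, by rw [hc]; ring, fun i => ?_⟩
  exact dvd_sub ((dvd_mul_left _ _).trans (h i)) (Dvd.intro_left (c * γ i) (by ring))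

theorem eq_smul_of_mem_lineLattice {γ : Fin d → ℤ} {i₀ : Fin d} {Q R : ℤ}
    (hmax : ∀ i, |γ i| ≤ |γ i₀|) (hQ : 2 * R < Q) {x : Fin d → ℤ} (hx : x ∈ lineLattice γ i₀ Q)
    (hR : ∀ i, |x i| ≤ R) : ∃ k : ℤ, x = k • γ := by
  obtain ⟨k, hk, hd⟩ := hx
  refine ⟨k, funext fun i => ?_⟩
  have h1 : |k * γ i| ≤ R := by
    refine le_trans ?_ (hR i₀)
    rw [hk, abs_mul, abs_mul]
    exact mul_le_mul_of_nonneg_left (hmax i) (abs_nonneg k)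
  have h2 : |x i - k * γ i| < Q := by
    have := abs_sub (x i) (k * γ i)
    have := hR i
    omega
  rw [Pi.smul_apply, smul_eq_mul, ← sub_eq_zero]
  exact Int.eq_zero_of_abs_lt_dvd (hd i) h2

/-- The box `[0, r)^d` in `ℤ^d`. -/
def intBox (d : ℕ) (r : ℤ) : Finset (Fin d → ℤ) := Fintype.piFinset fun _ => Finset.Ico 0 r

theorem mem_intBox {r : ℤ} {x : Fin d → ℤ} : x ∈ intBox d r ↔ ∀ i, 0 ≤ x i ∧ x i < r := by
  simp [intBox]

theorem card_intBox (d : ℕ) (r : ℤ) : (intBox d r).card = r.toNat ^ d := by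
  simp [intBox]

open Classical in
theorem eventually_card_sdiff_translate_le (δ : Fin d → ℤ) (K : ℕ) :
    ∀ᶠ r : ℤ in atTop, K * ((intBox d r).filter fun x => x - δ ∉ intBox d r).card
      ≤ (intBox d r).card := by
  have hlim : Tendsto (fun r : ℤ => ∏ i, (1 - (|δ i| : ℝ) * (r : ℝ)⁻¹)) atTop (𝓝 1) := by
    have : Tendsto (fun r : ℤ => ∏ i, (1 - (|δ i| : ℝ) * (r : ℝ)⁻¹)) atTop
        (𝓝 (∏ i : Fin d, (1 - |(δ i : ℝ)| * 0))) := by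
      refine tendsto_finsetProd _ fun i _ => tendsto_const_nhds.sub (tendsto_const_nhds.mul ?_)
      exact tendsto_inv_atTop_zero.comp tendsto_intCast_atTop_atTop
    simpa using this
  have hev := hlim.eventually_const_lt (show 1 - 1 / ((K : ℝ) + 1) < 1 by
    have : 0 < 1 / ((K : ℝ) + 1) := by positivity
    linarith)
  filter_upwards [hev, eventually_gt_atTop 0, eventually_all.2 fun i => eventually_ge_atTop |δ i|]
    with r hr hr0 hrδ
  have hr0' : (0 : ℝ) < r := by exact_mod_cast hr0
  have hsub : (Fintype.piFinset fun i => Finset.Ico (max 0 (δ i)) (min r (r + δ i))) ⊆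
      (intBox d r).filter fun x => ¬ (x - δ ∉ intBox d r) := by
    intro x hx
    simp only [Fintype.mem_piFinset, Finset.mem_Ico, max_le_iff, lt_min_iff] at hx
    simp only [Finset.mem_filter, mem_intBox, not_not, Pi.sub_apply]
    exact ⟨fun i => ⟨(hx i).1.1, (hx i).2.1⟩, fun i => ⟨by linarith [hx i], by linarith [hx i]⟩⟩
  have h1 := Finset.card_le_card hsub
  have h2 := Finset.card_filter_add_card_filter_not (s := intBox d r)
    (fun x => x - δ ∉ intBox d r)
  have h3 : ((Fintype.piFinset fun i =>
      Finset.Ico (max 0 (δ i)) (min r (r + δ i))).card : ℝ)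
      = (intBox d r).card * ∏ i, (1 - (|δ i| : ℝ) * (r : ℝ)⁻¹) := by
    have hc : ((intBox d r).card : ℝ) = ∏ _i : Fin d, (r : ℝ) := by
      rw [card_intBox]
      push_cast
      rw [← Int.cast_natCast, Int.toNat_of_nonneg hr0.le]
      simp
    rw [hc, ← Finset.prod_mul_distrib, Fintype.card_piFinset]
    push_cast
    refine Finset.prod_congr rfl fun i _ => ?_
    rw [Int.card_Ico, ← Int.cast_natCast, Int.toNat_of_nonneg]
    · rw [mul_sub, mul_comm _ (r : ℝ)⁻¹, mul_inv_cancel_left₀ hr0'.ne', mul_one]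
      have : min r (r + δ i) - max 0 (δ i) = r - |δ i| := by
        rcases le_total 0 (δ i) with h | h
        · rw [abs_of_nonneg h, max_eq_right h, min_eq_left (by omega)]
        · rw [abs_of_nonpos h, max_eq_left h, min_eq_right (by omega)]
          omega
      rw [this]
      push_cast
      rfl
    · have := hrδ i
      have := abs_le.1 this
      omega
  set A := ((intBox d r).filter fun x => x - δ ∉ intBox d r).card
  set B := (intBox d r).card
  have h4 : (A : ℝ) + B * ∏ i, (1 - (|δ i| : ℝ) * (r : ℝ)⁻¹) ≤ B := by
    rw [← h3]
    exact_mod_cast (Nat.add_le_add_left h1 A).trans h2.le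
  have h5 : (A : ℝ) ≤ B * (1 / ((K : ℝ) + 1)) := by
    have : (B : ℝ) * (1 - 1 / ((K : ℝ) + 1)) ≤ B * ∏ i, (1 - (|δ i| : ℝ) * (r : ℝ)⁻¹) := by
      gcongr
    linarith
  rw [mul_one_div, le_div_iff₀ (by positivity)] at h5
  have : (K : ℝ) * A ≤ B := by
    have : (0 : ℝ) ≤ A := by positivity
    linarith
  exact_mod_cast this

end Lattice

section Construction

variable {d : ℕ}

/-- The data available at one stage of the inductive construction: integers `period` and `size`,
the vectors chosen so far, the last of these vectors, and a lattice containing it. -/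
structure Stage (d : ℕ) where
  period : ℤ
  period_pos : 0 < period
  size : ℤ
  size_pos : 0 < size
  vectors : Finset (Fin d → ℤ)
  vec : Fin d → ℤ
  lattice : AddSubgroup (Fin d → ℤ)

open Classical in
/-- The relation between consecutive stages `s` and `s'` of the construction, where `s'` follows
the direction of `p` up to an error controlled by `ρ` and `n`. -/
structure IsStep (n : ℕ) (p : Fin d → ℝ) (ρ : ℝ) (s s' : Stage d) : Prop where
  near : ∃ t : ℝ, ‖zcast s'.vec - t • p‖ < 1 / (n + 1) ∧ 2 + s.size < |t| * ρ
  large : ∃ i, s.size ≤ |s'.vec i|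
  period_dvd_vec : ∀ i, s.period ∣ s'.vec i
  vec_mem : s'.vec ∈ s'.lattice
  period_dvd : s.period ∣ s'.period
  mem_lattice : ∀ x : Fin d → ℤ, (∀ i, s'.period ∣ x i) → x ∈ s'.lattice
  size_lt : s.size < s'.size
  vectors_eq : s'.vectors = insert s'.vec s.vectors
  card_le : ∀ δ ∈ s'.vectors,
    4 ^ (n + 1) * ((intBox d s'.size).filter fun x => x - δ ∉ intBox d s'.size).card
      ≤ (intBox d s'.size).card
  eq_smul : ∀ x ∈ s'.lattice, (∀ i, |x i| ≤ s.size + s'.size) → ∃ k : ℤ, x = k • s'.vec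

theorem exists_isStep (n : ℕ) {p : Fin d → ℝ} (hp : p ≠ 0) {ρ : ℝ} (hρ : 0 < ρ) (s : Stage d) :
    ∃ s', IsStep n p ρ s s' := by
  classical
  have hn : (0 : ℝ) < 1 / (n + 1) := by positivity
  have hn1 : (1 : ℝ) / (n + 1) ≤ 1 := by
    rw [div_le_one (by positivity)]
    linarith [n.cast_nonneg (α := ℝ)]
  have hs : (0 : ℝ) < s.size := by exact_mod_cast s.size_pos
  have hp' : 0 < ‖p‖ := norm_pos_iff.2 hp
  obtain ⟨γ, t, hγ, ht, hdvd⟩ := exists_int_near_line p hn s.period_pos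
    (max ((3 + s.size) / ρ) ((1 + s.size) / ‖p‖))
  have ht1 : 2 + s.size < |t| * ρ := by
    have := (div_le_iff₀ hρ).1 ((le_max_left _ _).trans ht)
    linarith
  have ht2 := (div_le_iff₀ hp').1 ((le_max_right _ _).trans ht)
  have hlarge : ∃ i, s.size ≤ |γ i| := by
    by_contra! hc
    have h1 : ‖zcast γ‖ ≤ s.size := (pi_norm_le_iff_of_nonneg hs.le).2 fun i => by
      rw [zcast, Real.norm_eq_abs]
      exact_mod_cast (hc i).le
    have h2 : ‖t • p‖ < ‖zcast γ‖ + 1 := by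
      have := norm_sub_norm_le (t • p) (zcast γ)
      rw [norm_sub_rev] at this
      linarith
    rw [norm_smul, Real.norm_eq_abs] at h2
    linarith
  obtain ⟨i₁, hi₁⟩ := hlarge
  obtain ⟨i₀, -, hi₀⟩ := Finset.exists_max_image Finset.univ (fun i => |γ i|)
    ⟨i₁, Finset.mem_univ _⟩
  have hpos : 0 < |γ i₀| := (s.size_pos.trans_le hi₁).trans_le (hi₀ i₁ (Finset.mem_univ _))
  obtain ⟨r, hr, hr'⟩ := ((eventually_gt_atTop s.size).and
    ((insert γ s.vectors).eventually_all.2 fun δ _ =>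
      eventually_card_sdiff_translate_le δ (4 ^ (n + 1)))).exists
  have hr0 : 0 < r := s.size_pos.trans hr
  set Q : ℤ := 2 * (s.size + r) + 1
  have hQ : 0 < Q := by have := s.size_pos; omega
  refine ⟨⟨s.period * (|γ i₀| * Q), mul_pos s.period_pos (mul_pos hpos hQ), r, hr0,
    insert γ s.vectors, γ, lineLattice γ i₀ Q⟩, ⟨t, hγ, ht1⟩, ⟨i₁, hi₁⟩, hdvd,
    ⟨1, by simp⟩, dvd_mul_right _ _, fun x hx => mem_lineLattice_of_dvd fun i =>
      (dvd_mul_left _ _).trans (hx i), hr, rfl, hr', fun x hx hR => ?_⟩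
  exact eq_smul_of_mem_lineLattice (fun i => hi₀ i (Finset.mem_univ _)) (lt_add_one _) hx hR

theorem exists_stages (p : ℕ → Fin d → ℝ) (hp : ∀ n, p n ≠ 0) (ρ : ℕ → ℝ) (hρ : ∀ n, 0 < ρ n) :
    ∃ s : ℕ → Stage d, (s 0).size = 1 ∧ ∀ n, IsStep n (p n) (ρ n) (s n) (s (n + 1)) := by
  choose f hf using fun n => exists_isStep n (hp n) (hρ n)
  exact ⟨Nat.rec ⟨1, one_pos, 1, one_pos, ∅, 0, ⊥⟩ f, rfl, fun n => hf n _⟩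

section Stages

variable {p : ℕ → Fin d → ℝ} {ρ : ℕ → ℝ} {s : ℕ → Stage d}
  (hs : ∀ n, IsStep n (p n) (ρ n) (s n) (s (n + 1)))

include hs

theorem period_dvd_of_le {m n : ℕ} (h : m ≤ n) : (s m).period ∣ (s n).period := by
  induction n, h using Nat.le_induction with
  | base => exact dvd_rfl
  | succ n _ ih => exact ih.trans (hs n).period_dvd

theorem vec_mem_lattice {m n : ℕ} (h : n ≤ m) : (s (m + 1)).vec ∈ (s (n + 1)).lattice := by
  rcases h.eq_or_lt with rfl | h
  · exact (hs n).vec_mem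
  · exact (hs n).mem_lattice _ fun i => (period_dvd_of_le hs h).trans ((hs m).period_dvd_vec i)

theorem vec_mem_vectors {m n : ℕ} (h : m ≤ n) : (s (m + 1)).vec ∈ (s (n + 1)).vectors := by
  classical
  induction n, h using Nat.le_induction with
  | base => rw [(hs m).vectors_eq]; exact Finset.mem_insert_self _ _
  | succ n _ ih => rw [(hs (n + 1)).vectors_eq]; exact Finset.mem_insert_of_mem ih

theorem eq_zero_of_mem_lattice {n : ℕ} {x : Fin d → ℤ} (hx : x ∈ (s (n + 1)).lattice)
    (h : ∀ i, |x i| < (s n).size) : x = 0 := by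
  obtain ⟨k, rfl⟩ := (hs n).eq_smul x hx fun i =>
    (h i).le.trans (by linarith [(s (n + 1)).size_pos])
  obtain ⟨i, hi⟩ := (hs n).large
  have := h i
  rw [Pi.smul_apply, smul_eq_mul, abs_mul] at this
  have hk : |k| < 1 := by
    by_contra! hc
    nlinarith [abs_nonneg ((s (n + 1)).vec i)]
  rw [Int.abs_lt_one_iff.1 hk, zero_smul]

theorem lt_size (h0 : (s 0).size = 1) (n : ℕ) : (n : ℤ) < (s n).size := by
  induction n with
  | zero => simp [h0]
  | succ n ih => have := (hs n).size_lt; push_cast; omega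

theorem eq_zero_of_forall_mem_lattice (h0 : (s 0).size = 1) {x : Fin d → ℤ}
    (hx : ∀ n, x ∈ (s (n + 1)).lattice) : x = 0 := by
  obtain ⟨n, hn⟩ : ∃ n : ℕ, ∀ i, |x i| ≤ n := by
    refine ⟨Finset.univ.sup fun i => (x i).natAbs, fun i => ?_⟩
    have := Finset.le_sup (f := fun i => (x i).natAbs) (Finset.mem_univ i)
    rw [Int.abs_eq_natAbs]
    exact_mod_cast this
  exact eq_zero_of_mem_lattice hs (hx n) fun i => (hn i).trans_lt (lt_size hs h0 n)

theorem exists_near_of_add_mem_lattice (h0 : (s 0).size = 1) {γ : Fin d → ℤ} (hγ : γ ≠ 0) :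
    ∃ n, ∀ x ∈ intBox d (s n).size, ∀ y ∈ intBox d (s n).size, γ + y - x ∈ (s (n + 1)).lattice →
      ∃ c : ℝ, c ≠ 0 ∧ ∀ v : Fin d → ℝ, ‖zcast γ - v‖ < 1 → ‖c⁻¹ • v - p n‖ < ρ n := by
  obtain ⟨n, ⟨i₁, hi₁⟩, hn⟩ : ∃ n, (∃ i, (s n).size ≤ |γ i|) ∧ ∀ i, |γ i| < (s (n + 1)).size := by
    have hex : ∃ n, ∀ i, |γ i| < (s n).size := by
      refine ⟨Finset.univ.sup fun i => (γ i).natAbs, fun i => ?_⟩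
      refine lt_of_le_of_lt ?_ (lt_size hs h0 _)
      have := Finset.le_sup (f := fun i => (γ i).natAbs) (Finset.mem_univ i)
      rw [Int.abs_eq_natAbs]
      exact_mod_cast this
    classical
    cases hm : Nat.find hex with
    | zero =>
      have := Nat.find_spec hex
      rw [hm, h0] at this
      exact absurd (funext fun i => Int.abs_lt_one_iff.1 (this i)) hγ
    | succ m =>
      refine ⟨m, ?_, hm ▸ Nat.find_spec hex⟩
      have := Nat.find_min hex (m := m) (by omega)
      push Not at this
      exact this
  refine ⟨n, fun x hx y hy hmem => ?_⟩
  rw [mem_intBox] at hx hy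
  have hyx : ∀ i, |y i - x i| < (s n).size := fun i => abs_lt.2
    ⟨by linarith [hx i, hy i], by linarith [hx i, hy i]⟩
  obtain ⟨k, hk⟩ := (hs n).eq_smul _ hmem fun i => by
    have h1 := abs_add_le (γ i) (y i - x i)
    rw [← add_sub_assoc] at h1
    change |γ i + y i - x i| ≤ _
    linarith [hyx i, hn i]
  have hk0 : k ≠ 0 := by
    rintro rfl
    have h1 := congrFun hk i₁
    simp only [Pi.sub_apply, Pi.add_apply, zero_smul, Pi.zero_apply] at h1
    have := hyx i₁
    rw [show y i₁ - x i₁ = -γ i₁ by linarith, abs_neg] at this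
    omega
  obtain ⟨t, ht, htρ⟩ := (hs n).near
  have hk1 : (1 : ℝ) ≤ |(k : ℝ)| := by exact_mod_cast Int.one_le_abs hk0
  have hsz : (0 : ℝ) < (s n).size := by exact_mod_cast (s n).size_pos
  have ht0 : t ≠ 0 := by
    rintro rfl
    rw [abs_zero, zero_mul] at htρ
    linarith
  have hkR : (k : ℝ) ≠ 0 := by exact_mod_cast hk0
  have hc : (k : ℝ) * t ≠ 0 := mul_ne_zero hkR ht0
  refine ⟨k * t, hc, fun v hv => ?_⟩
  have e : v - ((k : ℝ) * t) • p n = -(zcast γ - v) + -(zcast y - zcast x)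
      + (k : ℝ) • (zcast (s (n + 1)).vec - t • p n) := by
    ext i
    have h1 := congrArg (Int.cast (R := ℝ)) (congrFun hk i)
    simp only [Pi.sub_apply, Pi.add_apply, Pi.smul_apply, smul_eq_mul, Pi.neg_apply, zcast] at h1 ⊢
    push_cast at h1
    linear_combination h1
  have h2 : ‖zcast y - zcast x‖ ≤ (s n).size := (pi_norm_le_iff_of_nonneg hsz.le).2 fun i => by
    rw [Pi.sub_apply, zcast, zcast, Real.norm_eq_abs]
    exact_mod_cast (hyx i).le
  have h3 : (1 : ℝ) / (n + 1) ≤ 1 := by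
    rw [div_le_one (by positivity)]
    linarith [n.cast_nonneg (α := ℝ)]
  have h4 : ‖v - ((k : ℝ) * t) • p n‖ < |(k : ℝ)| * (|t| * ρ n) := by
    calc ‖v - ((k : ℝ) * t) • p n‖ ≤ ‖zcast γ - v‖ + ‖zcast y - zcast x‖
          + |(k : ℝ)| * ‖zcast (s (n + 1)).vec - t • p n‖ := by
          rw [e]
          refine (norm_add_le _ _).trans (add_le_add ((norm_add_le _ _).trans ?_) ?_)
          · rw [norm_neg, norm_neg]
          · rw [norm_smul, Real.norm_eq_abs]
      _ ≤ 1 + (s n).size + |(k : ℝ)| * 1 := by gcongr; exact ht.le.trans h3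
      _ ≤ |(k : ℝ)| * (2 + (s n).size) := by nlinarith
      _ < _ := by gcongr
  rw [← inv_smul_smul₀ hc (p n), ← smul_sub, norm_smul, norm_inv, norm_mul, Real.norm_eq_abs,
    Real.norm_eq_abs, inv_mul_lt_iff₀ (by positivity), mul_assoc]
  exact h4

end Stages

end Construction

section Core

variable {d : ℕ}

theorem discreteMeasurableSpace_quotient (Λ : AddSubgroup (Fin d → ℤ)) :
    DiscreteMeasurableSpace ((Fin d → ℤ) ⧸ Λ) :=
  ⟨fun _ => measurableSet_quotient.2 .of_discrete⟩

open Classical in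
theorem uniformOn_image_compl_translate_le {Λ : AddSubgroup (Fin d → ℤ)} {F : Finset (Fin d → ℤ)}
    (hF : F.Nonempty) (hinj : InjOn (QuotientAddGroup.mk' Λ) F) (δ : Fin d → ℤ) {K : ℕ} (hK : K ≠ 0)
    (h : K * (F.filter fun x => x - δ ∉ F).card ≤ F.card) :
    ProbabilityTheory.uniformOn (QuotientAddGroup.mk' Λ '' F)
      ((fun y => QuotientAddGroup.mk' Λ δ + y) '' (QuotientAddGroup.mk' Λ '' F))ᶜ
      ≤ (K : ENNReal)⁻¹ := by
  have := discreteMeasurableSpace_quotient Λ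
  have hI : Measure.count (QuotientAddGroup.mk' Λ '' F) = (F.card : ENNReal) := by
    rw [Measure.count_apply .of_discrete, hinj.encard_image, encard_coe_eq_coe_finsetCard]
    simp
  have hJ : Measure.count (QuotientAddGroup.mk' Λ '' F ∩
      ((fun y => QuotientAddGroup.mk' Λ δ + y) '' (QuotientAddGroup.mk' Λ '' F))ᶜ)
      ≤ ((F.filter fun x => x - δ ∉ F).card : ENNReal) := by
    have hsub : QuotientAddGroup.mk' Λ '' F ∩
        ((fun y => QuotientAddGroup.mk' Λ δ + y) '' (QuotientAddGroup.mk' Λ '' F))ᶜ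
        ⊆ QuotientAddGroup.mk' Λ '' (F.filter fun x => x - δ ∉ F) := by
      rintro _ ⟨⟨x, hx, rfl⟩, hx'⟩
      refine ⟨x, Finset.mem_coe.2 (Finset.mem_filter.2 ⟨hx, fun hc => hx' ?_⟩), rfl⟩
      exact ⟨_, ⟨x - δ, hc, rfl⟩, by simp⟩
    refine (measure_mono hsub).trans ?_
    rw [Measure.count_apply .of_discrete]
    have := encard_image_le (QuotientAddGroup.mk' Λ)
      (F.filter fun x => x - δ ∉ F : Set (Fin d → ℤ))
    rw [encard_coe_eq_coe_finsetCard] at this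
    exact_mod_cast this
  rw [ProbabilityTheory.uniformOn, ProbabilityTheory.cond_apply .of_discrete, hI]
  have hF0 : (F.card : ENNReal) ≠ 0 := by exact_mod_cast hF.card_pos.ne'
  rw [mul_comm, ← div_eq_mul_inv, ENNReal.div_le_iff hF0 (ENNReal.natCast_ne_top _), mul_comm,
    ← div_eq_mul_inv, ENNReal.le_div_iff_mul_le (by simp [hK]) (by simp)]
  refine (mul_le_mul_left hJ _).trans ?_
  rw [mul_comm]
  exact_mod_cast h

theorem exists_ball_subset {U : Set (Projectivization ℝ (Fin d → ℝ))} (hU : IsOpen U)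
    {θ : Projectivization ℝ (Fin d → ℝ)} (hθ : θ ∈ U) :
    ∃ ρ : ℝ, 0 < ρ ∧ ∀ θ' : Projectivization ℝ (Fin d → ℝ), ∀ w ∈ θ'.submodule,
      ‖w - θ.rep‖ < ρ → θ' ∈ U := by
  have hcont : Continuous
      (fun v : {v : Fin d → ℝ // v ≠ 0} => Projectivization.mk ℝ v.1 v.2) := continuous_quotient_mk'
  have hmem : (⟨θ.rep, θ.rep_nonzero⟩ : {v : Fin d → ℝ // v ≠ 0}) ∈
      (fun v : {v : Fin d → ℝ // v ≠ 0} => Projectivization.mk ℝ v.1 v.2) ⁻¹' U := by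
    simpa using hθ
  obtain ⟨ρ, hρ, hball⟩ := Metric.isOpen_iff.1 (hU.preimage hcont) _ hmem
  refine ⟨min ρ ‖θ.rep‖, lt_min hρ (norm_pos_iff.2 θ.rep_nonzero), fun θ' w hw hd => ?_⟩
  have hw0 : w ≠ 0 := by
    rintro rfl
    rw [zero_sub, norm_neg] at hd
    exact absurd (hd.trans_le (min_le_right _ _)) (lt_irrefl _)
  have h1 : Projectivization.mk ℝ w hw0 ∈ U := by
    refine hball (a := ⟨w, hw0⟩) ?_
    rw [Metric.mem_ball, Subtype.dist_eq, dist_eq_norm]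
    exact hd.trans_le (min_le_left _ _)
  convert h1
  rw [← θ'.mk_rep, Projectivization.mk_eq_mk_iff']
  rw [Projectivization.submodule_eq, Submodule.mem_span_singleton] at hw
  obtain ⟨a, rfl⟩ := hw
  have ha : a ≠ 0 := fun h => hw0 (by rw [h, zero_smul])
  exact ⟨a⁻¹, inv_smul_smul₀ ha _⟩

theorem exists_action_empty (d : ℕ) :
    ∃ (X : Type) (_ : MeasurableSpace X), StandardBorelSpace X ∧
      ∃ μ : Measure X, SigmaFinite μ ∧ 1 ≤ μ univ ∧
        ∃ T : (Fin d → ℤ) → X ≃ᵐ X, IsMPAction μ T ∧ IsFreeAction μ T ∧ recSet μ T = ∅ := by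
  refine ⟨Fin d → ℤ, inferInstance, inferInstance, Measure.count, inferInstance, ?_,
    fun γ => MeasurableEquiv.addLeft γ, ⟨fun γ γ' x => add_assoc _ _ _, fun γ => ?_⟩,
    fun γ hγ => .of_forall fun x => by simpa using hγ, ?_⟩
  · rw [← Measure.count_singleton (0 : Fin d → ℤ)]
    exact measure_mono (subset_univ _)
  · refine ⟨(MeasurableEquiv.addLeft γ).measurable, ?_⟩
    ext s -
    rw [MeasurableEquiv.map_apply, ← Measure.count_injective_image
      (MeasurableEquiv.addLeft γ).injective, image_preimage_eq _
      (MeasurableEquiv.addLeft γ).surjective]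
  · refine eq_empty_of_forall_notMem fun θ hθ => ?_
    obtain ⟨γ, hγ, v, -, -, h⟩ := hθ 1 one_pos {0} .of_discrete (by simp)
    refine h.ne' (measure_mono_null ?_ measure_empty)
    rintro _ ⟨rfl, y, rfl, hy⟩
    exact hγ (by simpa using hy)

theorem exists_action_of_isOpen {D U : Set (Projectivization ℝ (Fin d → ℝ))} (hD : D.Countable)
    (hU : IsOpen U) (hDU : D ⊆ U) :
    ∃ (X : Type) (_ : MeasurableSpace X), StandardBorelSpace X ∧
      ∃ μ : Measure X, SigmaFinite μ ∧ 1 ≤ μ univ ∧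
        ∃ T : (Fin d → ℤ) → X ≃ᵐ X, IsMPAction μ T ∧ IsFreeAction μ T ∧
          D ⊆ recSet μ T ∧ recSet μ T ⊆ U := by
  rcases D.eq_empty_or_nonempty with rfl | hne
  · obtain ⟨X, hX, hB, μ, hσ, h1, T, hT, hf, he⟩ := exists_action_empty d
    exact ⟨X, hX, hB, μ, hσ, h1, T, hT, hf, empty_subset _, he ▸ empty_subset _⟩
  obtain ⟨g, hg⟩ := hD.exists_eq_range hne
  choose ρ hρ hρU using fun n : ℕ => exists_ball_subset hU
    (hDU (hg ▸ mem_range_self n.unpair.1 : g n.unpair.1 ∈ D))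
  obtain ⟨s, h0, hs⟩ := exists_stages (fun n => (g n.unpair.1).rep)
    (fun n => Projectivization.rep_nonzero _) ρ hρ
  have hdisc n := discreteMeasurableSpace_quotient (s (n + 1)).lattice
  set G : ℕ → Type := fun n => (Fin d → ℤ) ⧸ (s (n + 1)).lattice
  let π : ∀ n, (Fin d → ℤ) →+ G n := fun n => QuotientAddGroup.mk' (s (n + 1)).lattice
  let I : ∀ n, Set (G n) := fun n => π n '' intBox d (s n).size
  have hπ : ∀ n x, π n x = 0 ↔ x ∈ (s (n + 1)).lattice := fun n x =>
    QuotientAddGroup.eq_zero_iff x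
  have hbox : ∀ n, (intBox d (s n).size).Nonempty := fun n =>
    ⟨0, mem_intBox.2 fun i => ⟨le_rfl, (s n).size_pos⟩⟩
  have hI : ∀ n, (I n).Finite := fun n => (Finset.finite_toSet _).image _
  have hI' : ∀ n, (I n).Nonempty := fun n => Set.Nonempty.image _ (hbox n)
  have hinj : ∀ n, InjOn (π n) (intBox d (s n).size) := by
    intro n x hx y hy hxy
    rw [Finset.mem_coe, mem_intBox] at hx hy
    rw [← sub_eq_zero]
    refine eq_zero_of_mem_lattice hs ((hπ n _).1 (by rw [map_sub, hxy, sub_self])) fun i => ?_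
    exact abs_lt.2 ⟨by have := hx i; have := hy i; simp only [Pi.sub_apply]; omega,
      by have := hx i; have := hy i; simp only [Pi.sub_apply]; omega⟩
  have := isProbabilityMeasure_piUniform hI hI'
  have hT := piTranslation_action π
  have hsmall : ∀ m, piUniform I (piTranslation (fun n => π n (s (m + 1)).vec) '' univ.pi I)ᶜ
      ≤ (2 : ENNReal)⁻¹ ^ m * 2 := by
    intro m
    have htwo : ∑' n : ℕ, (2 : ENNReal)⁻¹ ^ n = 2 := by
      rw [ENNReal.tsum_geometric, ENNReal.one_sub_inv_two, inv_inv]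
    rw [piTranslation_image_pi]
    refine (piUniform_pi_compl_le hI hI' _).trans ?_
    refine le_of_le_of_eq ?_ (congrArg ((2 : ENNReal)⁻¹ ^ m * ·) htwo)
    rw [← ENNReal.tsum_mul_left]
    refine ENNReal.tsum_le_tsum fun n => ?_
    rcases le_or_gt n m with hnm | hnm
    · rw [(hπ n _).2 (vec_mem_lattice hs hnm)]
      have := ProbabilityTheory.isProbabilityMeasure_uniformOn (hI n) (hI' n)
      simp only [zero_add, image_id']
      rw [(prob_compl_eq_zero_iff .of_discrete).2 (ProbabilityTheory.uniformOn_self (hI n) (hI' n))]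
      exact zero_le
    · obtain ⟨k, rfl⟩ : ∃ k, n = k + 1 := ⟨n - 1, by omega⟩
      refine (uniformOn_image_compl_translate_le (hbox _) (hinj _) _ (K := 4 ^ (k + 1)) (by simp)
        ((hs k).card_le _ (vec_mem_vectors hs (by omega)))).trans ?_
      rw [← pow_add, ← ENNReal.inv_pow, ENNReal.inv_le_inv]
      calc (2 : ENNReal) ^ (m + (k + 1)) ≤ 2 ^ (2 * (k + 1)) :=
            pow_le_pow_right₀ (by norm_num) (by omega)
        _ = _ := by rw [pow_mul]; norm_num
  have hG : ∀ n, StandardBorelSpace (G n) := fun n =>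
    have : Countable (G n) := (QuotientAddGroup.mk'_surjective _).countable
    inferInstance
  refine ⟨∀ n, G n, inferInstance, inferInstance, odometerMeasure I π, ?_, ?_,
    fun γ => piTranslation fun n => π n γ, ⟨hT, measurePreserving_supMeasure hT⟩, ?_, ?_, ?_⟩
  · exact sigmaFinite_supMeasure hT (measurableSet_univ_pi I) (piUniform_compl hI hI')
      (piUniform_map_restrict_le hI hI' π)
  · rw [← measure_univ (μ := piUniform I)]
    exact le_supMeasure hT univ
  · refine fun γ hγ => .of_forall fun x hx => hγ (eq_zero_of_forall_mem_lattice hs h0 fun n => ?_)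
    rw [← hπ]
    simpa using congrFun hx n
  · intro θ hθ
    obtain ⟨a, rfl⟩ : θ ∈ range g := hg ▸ hθ
    refine recurrentAlong_odometer hI hI' π _ fun ε hε N η hη => ?_
    have hlim : Tendsto (fun m : ℕ => (2 : ENNReal)⁻¹ ^ m * 2) atTop (𝓝 0) := by
      simpa using ENNReal.Tendsto.mul_const (b := 2)
        (ENNReal.tendsto_pow_atTop_nhds_zero_of_lt_one (r := 2⁻¹) (by simp)) (by simp)
    obtain ⟨m₀, hm₀⟩ := eventually_atTop.1 ((hlim.eventually_lt_const hη).and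
      ((tendsto_one_div_add_atTop_nhds_zero_nat (𝕜 := ℝ)).eventually_lt_const hε))
    set b := max N m₀
    set m := Nat.pair a b
    have hm : b ≤ m := Nat.right_le_pair a b
    obtain ⟨h1, h2⟩ := hm₀ m ((le_max_right _ _).trans hm)
    refine ⟨(s (m + 1)).vec, ?_, ?_, fun n hn => ?_, (hsmall m).trans_lt h1⟩
    · obtain ⟨i, hi⟩ := (hs m).large
      intro hc
      rw [hc, Pi.zero_apply, abs_zero] at hi
      exact absurd hi (s m).size_pos.not_ge
    · obtain ⟨t, ht, -⟩ := (hs m).near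
      refine ⟨_, Submodule.smul_mem _ t ?_, ht.trans h2⟩
      rw [Nat.unpair_pair, Projectivization.submodule_eq]
      exact Submodule.mem_span_singleton_self _
    · exact (hπ n _).2 (vec_mem_lattice hs ((hn.le.trans (le_max_left _ _)).trans hm))
  · intro θ hθ
    by_contra hc
    refine not_recurrentAlong_odometer hI hI' π θ ?_ hθ
    rintro γ hγ ⟨v, hv, hd⟩
    obtain ⟨n, hn⟩ := exists_near_of_add_mem_lattice hs h0 hγ
    refine ⟨n, ?_⟩
    rintro _ ⟨x, hx, rfl⟩ _ ⟨y, hy, rfl⟩ hxy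
    obtain ⟨c, -, h⟩ := hn x hx y hy ((hπ n _).1 (by rw [map_sub, map_add, ← hxy, sub_self]))
    exact hc (hρU n θ _ (Submodule.smul_mem _ c⁻¹ hv) (h v hd))

end Core

/-- every countable `G_δ`-subset of `P(ℝ^d)` is the set of recurrent directions of
some free infinite measure preserving `ℤ^d`-action. -/
theorem countable_Gδ_is_recurrence_set {d : ℕ} (hd : 1 ≤ d)
    (D : Set (Projectivization ℝ (Fin d → ℝ))) (hDc : D.Countable) (hD : IsGδ D) :
    ∃ (X : Type) (_ : MeasurableSpace X), StandardBorelSpace X ∧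
      ∃ μ : Measure X, SigmaFinite μ ∧ μ Set.univ = ⊤ ∧
        ∃ T : (Fin d → ℤ) → X ≃ᵐ X, IsMPAction μ T ∧ IsFreeAction μ T ∧
          recSet μ T = D := by
  obtain ⟨U, hU, rfl⟩ := hD.eq_iInter_nat
  choose X mX hX μ hσ hμ T hT hf hD hDU using fun i : ℕ × ℕ =>
    exists_action_of_isOpen hDc (hU i.1) (iInter_subset U i.1)
  refine ⟨Σ i, X i, inferInstance, standardBorelSpace_sigma, sigmaMeasure μ,
    sigmaFinite_sigmaMeasure, ?_, sigmaAction T, isMPAction_sigmaAction hT,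
    isFreeAction_sigmaAction hf, ?_⟩
  · rw [sigmaMeasure_apply, ← top_le_iff, ← ENNReal.tsum_const_eq_top_of_ne_zero (α := ℕ × ℕ)
      one_ne_zero]
    exact ENNReal.tsum_le_tsum hμ
  · rw [recSet_sigmaAction]
    refine Subset.antisymm (fun θ hθ => mem_iInter.2 fun n => ?_) (subset_iInter hD)
    exact hDU (n, 0) (mem_iInter.1 hθ (n, 0))
end
end
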